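/- Let n ≥ 2, μ ∈ Δ, and K ∈ 𝒦. If f and g are finite linear combinations of characteristic functions of closed rectangles in ℝⁿ (i.e., images under rigid motions of closed axis-parallel boxes; the sides need not be parallel to the coordinate axes), then the limit lim_{ε→0} ∫ T^ε_{μ,K} f(x) g(x) dμ(x) exists and is finite. -/

import Mathlib

open MeasureTheory Metric ENNReal Filter Set Topology

noncomputable section

/-- The truncated singular integral operator `T^ε_{μ,K}`. -/
def trunc {n : ℕ} (μ : Measure (EuclideanSpace ℝ (Fin n)))
    (K : EuclideanSpace ℝ (Fin n) → ℝ) (ε : ℝ)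
    (g : EuclideanSpace ℝ (Fin n) → ℝ) (x : EuclideanSpace ℝ (Fin n)) : ℝ :=
  ∫ y in (closedBall x ε)ᶜ, K (x - y) * g y ∂μ

/-- A closed rectangle in `ℝⁿ`: the image under a rigid motion `x ↦ R x + v` of a closed
axis-parallel box `{p | ∀ i, lo i ≤ p i ≤ hi i}`. -/
def closedRectangle {n : ℕ} (R : EuclideanSpace ℝ (Fin n) ≃ₗᵢ[ℝ] EuclideanSpace ℝ (Fin n))
    (v : EuclideanSpace ℝ (Fin n)) (lo hi : Fin n → ℝ) : Set (EuclideanSpace ℝ (Fin n)) :=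
  (fun x => R x + v) '' {p : EuclideanSpace ℝ (Fin n) | ∀ i, lo i ≤ p i ∧ p i ≤ hi i}

section Growth

variable {X : Type*} [PseudoMetricSpace X] [MeasurableSpace X] [OpensMeasurableSpace X]

/-- Polynomial growth of degree `d` of a measure, with constant `C`. -/
structure HasGrowth (μ : Measure X) (d : ℕ) (C : ℝ) : Prop where
  nonneg : 0 ≤ C
  le : ∀ (x : X) (r : ℝ), 0 < r → μ (closedBall x r) ≤ ENNReal.ofReal (C * r ^ d)

theorem HasGrowth.restrict {X : Type*} [PseudoMetricSpace X] [MeasurableSpace X]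
    {μ : Measure X} {d : ℕ} {C : ℝ} (h : HasGrowth μ d C) (s : Set X) :
    HasGrowth (μ.restrict s) d C :=
  ⟨h.nonneg, fun x r hr => (Measure.restrict_apply_le _ _).trans (h.le x r hr)⟩

/-- If `w` is dominated by `c j` on the `j`-th set of a sequence of closed balls, then its
integral is controlled by the corresponding sum. -/
theorem lintegral_le_of_le_tsum_closedBall {μ : Measure X} {d : ℕ} {C : ℝ} (h : HasGrowth μ d C)
    (x : X) (w : X → ℝ≥0∞) (r c : ℕ → ℝ) (hr : ∀ j, 0 < r j) (hc : ∀ j, 0 ≤ c j) {S : ℝ}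
    (hS : HasSum (fun j => c j * (C * r j ^ d)) S)
    (hw : ∀ y, w y ≠ 0 → ∃ j, y ∈ closedBall x (r j) ∧ w y ≤ ENNReal.ofReal (c j)) :
    ∫⁻ y, w y ∂μ ≤ ENNReal.ofReal S := by
  have hnn : ∀ j, 0 ≤ c j * (C * r j ^ d) := fun j =>
    mul_nonneg (hc j) (mul_nonneg h.nonneg (pow_nonneg (hr j).le _))
  calc ∫⁻ y, w y ∂μ
      ≤ ∫⁻ y, ∑' j, (closedBall x (r j)).indicator (fun _ => ENNReal.ofReal (c j)) y ∂μ := by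
        refine lintegral_mono fun y => ?_
        by_cases h0 : w y = 0
        · simp [h0]
        obtain ⟨j, hj, hle⟩ := hw y h0
        refine hle.trans (le_trans ?_ (ENNReal.le_tsum j))
        simp [Set.indicator_of_mem hj]
    _ = ∑' j, ENNReal.ofReal (c j) * μ (closedBall x (r j)) := by
        rw [lintegral_tsum fun j =>
          (measurable_const.indicator isClosed_closedBall.measurableSet).aemeasurable]
        simp [lintegral_indicator, isClosed_closedBall.measurableSet]
    _ ≤ ∑' j, ENNReal.ofReal (c j * (C * r j ^ d)) := by
        refine ENNReal.tsum_le_tsum fun j => ?_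
        rw [ENNReal.ofReal_mul (hc j)]
        exact mul_le_mul_right (h.le x _ (hr j)) _
    _ = ENNReal.ofReal S := by
        rw [← ENNReal.ofReal_tsum_of_nonneg hnn hS.summable, hS.tsum_eq]

/-- Poisson-type kernels are uniformly integrable against measures of growth `d`. -/
theorem HasGrowth.lintegral_poisson_le {μ : Measure X} {d : ℕ} {C : ℝ} (h : HasGrowth μ d C)
    (x : X) {τ : ℝ} (hτ : 0 < τ) :
    ∫⁻ y, ENNReal.ofReal (τ / (τ + dist x y) ^ (d + 1)) ∂μ ≤ ENNReal.ofReal (C * 2 ^ (d + 2)) := by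
  have key := lintegral_le_of_le_tsum_closedBall h x
    (fun y => ENNReal.ofReal (τ / (τ + dist x y) ^ (d + 1)))
    (fun j => 2 ^ j * τ) (fun j => τ / (2 ^ j * τ / 2) ^ (d + 1)) (fun j => by positivity)
    (fun j => by positivity) (S := C * 2 ^ (d + 2)) ?_ ?_
  · exact key
  · have := (hasSum_geometric_two).mul_left (C * 2 ^ (d + 1))
    rw [show C * 2 ^ (d + 2) = C * 2 ^ (d + 1) * 2 by ring]
    refine Eq.subst (motive := fun f => HasSum f _) (funext fun j => ?_) this
    rw [div_pow, one_pow, div_pow]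
    field_simp
    ring
  · intro y _
    have hex : ∃ j : ℕ, dist y x ≤ 2 ^ j * τ := by
      obtain ⟨j, hj⟩ := pow_unbounded_of_one_lt (dist y x / τ) (one_lt_two (α := ℝ))
      exact ⟨j, by rw [div_lt_iff₀ hτ] at hj; exact hj.le⟩
    classical
    refine ⟨Nat.find hex, mem_closedBall.2 (Nat.find_spec hex), ?_⟩
    refine ENNReal.ofReal_le_ofReal (div_le_div_of_nonneg_left hτ.le (by positivity) ?_)
    refine pow_le_pow_left₀ (by positivity) ?_ _
    rcases hj : Nat.find hex with _ | j
    · have := dist_nonneg (x := x) (y := y); norm_num; linarith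
    · have h1 : ¬ dist y x ≤ 2 ^ j * τ := Nat.find_min hex (by omega)
      rw [dist_comm] at h1
      rw [pow_succ]; push Not at h1; nlinarith

/-- Integrability of the weakly singular kernel `|x - y|^{1 - d}` on balls. -/
theorem HasGrowth.lintegral_closedBall_le {μ : Measure X} {d : ℕ} {C : ℝ} (h : HasGrowth μ d C)
    (x : X) {r : ℝ} (hr : 0 < r) :
    ∫⁻ y in closedBall x r, ENNReal.ofReal (dist x y / dist x y ^ d) ∂μ
      ≤ ENNReal.ofReal (C * 2 ^ (d + 1) * r) := by
  rw [← lintegral_indicator isClosed_closedBall.measurableSet]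
  refine lintegral_le_of_le_tsum_closedBall h x _
    (fun j => (1 / 2) ^ j * r) (fun j => (1 / 2) ^ j * r / ((1 / 2) ^ j * r / 2) ^ d)
    (fun j => by positivity) (fun j => by positivity) ?_ ?_
  · have := (hasSum_geometric_two).mul_left (C * 2 ^ d * r)
    rw [show C * 2 ^ (d + 1) * r = C * 2 ^ d * r * 2 by ring]
    refine Eq.subst (motive := fun f => HasSum f _) (funext fun j => ?_) this
    rw [div_pow ((1 / 2) ^ j * r) 2 d]
    field_simp
  · intro y hy
    have hyB : y ∈ closedBall x r := by
      by_contra hn; exact hy (Set.indicator_of_notMem hn _)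
    rw [Set.indicator_of_mem hyB] at hy ⊢
    have hpos : 0 < dist y x := by
      rw [dist_comm]
      refine lt_of_le_of_ne dist_nonneg fun h0 => hy ?_
      rw [← h0]; simp
    have hex : ∃ j : ℕ, (1 / 2) ^ (j + 1) * r < dist y x := by
      obtain ⟨j, hj⟩ := exists_pow_lt_of_lt_one (div_pos hpos hr) (one_half_lt_one (α := ℝ))
      refine ⟨j, ?_⟩
      rw [lt_div_iff₀ hr] at hj
      refine lt_of_le_of_lt ?_ hj
      rw [pow_succ]
      have : 0 < (1 / 2 : ℝ) ^ j * r := by positivity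
      nlinarith
    classical
    have h1 : dist y x ≤ (1 / 2) ^ (Nat.find hex) * r := by
      rcases hj : Nat.find hex with _ | j
      · simpa using hyB
      · exact not_lt.1 (Nat.find_min hex (m := j) (by omega))
    have h2 := Nat.find_spec hex
    refine ⟨Nat.find hex, mem_closedBall.2 h1, ENNReal.ofReal_le_ofReal ?_⟩
    rw [dist_comm x y]
    gcongr
    rw [pow_succ] at h2
    linarith

end Growth

section Kernel

/-- Size and smoothness estimates of a Calderón–Zygmund kernel of degree `-d`. -/
structure IsCZ {V : Type*} [NormedAddCommGroup V] (k : V → ℝ) (d : ℕ) (C : ℝ) : Prop where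
  size : ∀ u, |k u| * ‖u‖ ^ d ≤ C
  smooth : ∀ u w, ‖u - w‖ ≤ ‖u‖ / 2 → |k u - k w| * ‖u‖ ^ (d + 1) ≤ C * ‖u - w‖

theorem IsCZ.nonneg {V : Type*} [NormedAddCommGroup V] {k : V → ℝ} {d : ℕ} {C : ℝ}
    (h : IsCZ k d C) : 0 ≤ C :=
  le_trans (by positivity) (h.size 0)

theorem IsCZ.abs_le {V : Type*} [NormedAddCommGroup V] {k : V → ℝ} {d : ℕ} {C : ℝ}
    (h : IsCZ k d C) {u : V} {r : ℝ} (hr : 0 < r) (hu : r ≤ ‖u‖) : |k u| ≤ C / r ^ d := by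
  rw [le_div_iff₀ (by positivity)]
  refine le_trans ?_ (h.size u)
  gcongr

theorem IsCZ.abs_sub_le {V : Type*} [NormedAddCommGroup V] {k : V → ℝ} {d : ℕ} {C : ℝ}
    (h : IsCZ k d C) {u w : V} {r s : ℝ} (hr : 0 < r) (hu : r ≤ ‖u‖) (hs : ‖u - w‖ ≤ s)
    (hsu : s ≤ ‖u‖ / 2) : |k u - k w| ≤ C * s / r ^ (d + 1) := by
  have hC := h.nonneg
  rw [le_div_iff₀ (by positivity)]
  calc |k u - k w| * r ^ (d + 1) ≤ |k u - k w| * ‖u‖ ^ (d + 1) := by gcongr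
    _ ≤ C * ‖u - w‖ := h.smooth u w (hs.trans hsu)
    _ ≤ C * s := by gcongr

variable {V : Type*} [NormedAddCommGroup V] [InnerProductSpace ℝ V] [FiniteDimensional ℝ V]
  [MeasurableSpace V] [BorelSpace V]

theorem HasGrowth.lintegral_enorm_le_of_poisson {X E : Type*} [PseudoMetricSpace X]
    [MeasurableSpace X] [OpensMeasurableSpace X] [NormedAddCommGroup E]
    {μ : Measure X} {d : ℕ} {c : ℝ} (hμ : HasGrowth μ d c) {f : X → E} {x : X} {A τ : ℝ}
    (hτ : 0 < τ) (hA : 0 ≤ A) (hf : ∀ y, ‖f y‖ ≤ A * (τ / (τ + dist x y) ^ (d + 1))) :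
    ∫⁻ y, ‖f y‖ₑ ∂μ ≤ ENNReal.ofReal (A * (c * 2 ^ (d + 2))) :=
  calc ∫⁻ y, ‖f y‖ₑ ∂μ
      ≤ ∫⁻ y, ENNReal.ofReal A * ENNReal.ofReal (τ / (τ + dist x y) ^ (d + 1)) ∂μ := by
        refine lintegral_mono fun y => ?_
        rw [← ENNReal.ofReal_mul hA, ← ofReal_norm]
        exact ENNReal.ofReal_le_ofReal (hf y)
    _ = ENNReal.ofReal A * ∫⁻ y, ENNReal.ofReal (τ / (τ + dist x y) ^ (d + 1)) ∂μ := by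
        rw [lintegral_const_mul' _ _ ENNReal.ofReal_ne_top]
    _ ≤ ENNReal.ofReal A * ENNReal.ofReal (c * 2 ^ (d + 2)) := by
        gcongr
        exact hμ.lintegral_poisson_le x hτ
    _ = _ := by rw [ENNReal.ofReal_mul hA]

theorem norm_integral_le_of_lintegral_enorm_le {X E : Type*} [MeasurableSpace X]
    [NormedAddCommGroup E] [NormedSpace ℝ E] {μ : Measure X} {f : X → E} {A : ℝ} (hA : 0 ≤ A)
    (h : ∫⁻ y, ‖f y‖ₑ ∂μ ≤ ENNReal.ofReal A) : ‖∫ y, f y ∂μ‖ ≤ A := by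
  have := (enorm_integral_le_lintegral_enorm f).trans h
  rwa [← ofReal_norm, ENNReal.ofReal_le_ofReal_iff hA] at this

/-- Integrating an odd kernel against a Lipschitz function over a ball gains cancellation. -/
theorem norm_setIntegral_closedBall_le_of_odd {k : V → ℝ} {d : ℕ} {c C : ℝ}
    (hV : HasGrowth (volume : Measure V) d c) (hk : IsCZ k d C) (hodd : ∀ u, k (-u) = -k u)
    (hint : Integrable k) {g : V → ℂ} (hg : Continuous g) {L r : ℝ} (hr : 0 < r) (hL : 0 ≤ L)
    (hgL : ∀ v ∈ closedBall (0 : V) r, ‖g v - g 0‖ ≤ L * ‖v‖) :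
    ‖∫ v in closedBall (0 : V) r, (k v : ℂ) * g v‖ ≤ C * L * (c * 2 ^ (d + 1) * r) := by
  have hC := hk.nonneg
  have hc := hV.nonneg
  have hB : MeasurableSet (closedBall (0 : V) r) := isClosed_closedBall.measurableSet
  have hzero : ∫ v in closedBall (0 : V) r, (k v : ℂ) = 0 := by
    have h1 : ∫ v, (closedBall (0 : V) r).indicator (fun v => (k v : ℂ)) (-v)
        = ∫ v, (closedBall (0 : V) r).indicator (fun v => (k v : ℂ)) v :=
      integral_neg_eq_self _ _
    have h2 : ∀ v, (closedBall (0 : V) r).indicator (fun v => (k v : ℂ)) (-v)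
        = - (closedBall (0 : V) r).indicator (fun v => (k v : ℂ)) v := by
      intro v
      by_cases hv : v ∈ closedBall (0 : V) r
      · rw [Set.indicator_of_mem hv, Set.indicator_of_mem (by simpa using hv)]
        simp [hodd]
      · rw [Set.indicator_of_notMem hv, Set.indicator_of_notMem (by simpa using hv)]
        simp
    simp_rw [h2] at h1
    rw [integral_neg, integral_indicator hB] at h1
    linear_combination (-1 / 2 : ℂ) * h1
  have hcint : IntegrableOn (fun v => (k v : ℂ)) (closedBall (0 : V) r) :=
    hint.ofReal.integrableOn
  have hlin : ∫⁻ v in closedBall (0 : V) r, ‖(k v : ℂ) * (g v - g 0)‖ₑ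
      ≤ ENNReal.ofReal (C * L * (c * 2 ^ (d + 1) * r)) := by
    calc ∫⁻ v in closedBall (0 : V) r, ‖(k v : ℂ) * (g v - g 0)‖ₑ
        ≤ ∫⁻ v in closedBall (0 : V) r,
            ENNReal.ofReal (C * L) * ENNReal.ofReal (dist 0 v / dist 0 v ^ d) := by
          refine setLIntegral_mono' hB fun v hv => ?_
          rw [← ENNReal.ofReal_mul (by positivity), ← ofReal_norm]
          refine ENNReal.ofReal_le_ofReal ?_
          rw [norm_mul, dist_zero_left, Complex.norm_real, Real.norm_eq_abs]
          rcases eq_or_ne v 0 with rfl | hv0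
          · simp
          · have hvp : 0 < ‖v‖ := norm_pos_iff.2 hv0
            calc |k v| * ‖g v - g 0‖ ≤ (C / ‖v‖ ^ d) * (L * ‖v‖) := by
                  gcongr
                  · exact hk.abs_le hvp le_rfl
                  · exact hgL v hv
              _ = _ := by ring
      _ = ENNReal.ofReal (C * L) *
            ∫⁻ v in closedBall (0 : V) r, ENNReal.ofReal (dist 0 v / dist 0 v ^ d) := by
          rw [lintegral_const_mul' _ _ ENNReal.ofReal_ne_top]
      _ ≤ ENNReal.ofReal (C * L) * ENNReal.ofReal (c * 2 ^ (d + 1) * r) := by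
          gcongr
          exact hV.lintegral_closedBall_le 0 hr
      _ = _ := (ENNReal.ofReal_mul (by positivity)).symm
  have hint2 : IntegrableOn (fun v => (k v : ℂ) * (g v - g 0)) (closedBall (0 : V) r) := by
    refine ⟨hcint.aestronglyMeasurable.mul
      (hg.sub continuous_const).aestronglyMeasurable, ?_⟩
    exact lt_of_le_of_lt hlin ENNReal.ofReal_lt_top
  have hsplit : ∫ v in closedBall (0 : V) r, (k v : ℂ) * g v
      = ∫ v in closedBall (0 : V) r, (k v : ℂ) * (g v - g 0) := by
    calc ∫ v in closedBall (0 : V) r, (k v : ℂ) * g v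
        = ∫ v in closedBall (0 : V) r, ((k v : ℂ) * (g v - g 0) + (k v : ℂ) * g 0) := by
          congr 1; ext v; ring
      _ = _ := by
          rw [integral_add hint2 (hcint.mul_const _), integral_mul_const, hzero]; simp
  rw [hsplit]
  exact norm_integral_le_of_lintegral_enorm_le (by positivity) hlin

open FourierTransform Real in
/-- The Fourier transform of an integrable odd Calderón–Zygmund kernel is bounded by a constant
that only depends on the kernel estimates. -/
theorem norm_fourier_le_of_isCZ_of_odd {k : V → ℝ} {d : ℕ} {c C : ℝ}
    (hV : HasGrowth (volume : Measure V) d c) (hk : IsCZ k d C) (hodd : ∀ u, k (-u) = -k u)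
    (hint : Integrable k) (ξ : V) :
    ‖𝓕 (fun v => (k v : ℂ)) ξ‖ ≤ C * (c * 6 ^ (d + 4)) := by
  have hC := hk.nonneg
  have hc := hV.nonneg
  have hcint : Integrable (fun v => (k v : ℂ)) := hint.ofReal
  rcases eq_or_ne ξ 0 with rfl | hξ
  · have h1 : ∫ v, (k (-v) : ℂ) = ∫ v, (k v : ℂ) := integral_neg_eq_self (fun v => (k v : ℂ)) _
    have h0 : ∫ v, (k v : ℂ) = 0 := by
      simp_rw [hodd, Complex.ofReal_neg] at h1
      rw [integral_neg] at h1
      linear_combination (-1 / 2 : ℂ) * h1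
    rw [Real.fourier_eq]
    simp [h0]
    positivity
  have hξp : 0 < ‖ξ‖ := norm_pos_iff.2 hξ
  set r : ℝ := ‖ξ‖⁻¹ with hr_def
  have hr : 0 < r := inv_pos.2 hξp
  set B : Set V := closedBall 0 r with hB_def
  have hB : MeasurableSet B := isClosed_closedBall.measurableSet
  set ch : V → ℂ := fun v => (𝐞 (-inner ℝ v ξ) : ℂ) with hch
  have hchc : Continuous ch := by
    have := Real.continuous_fourierChar
    fun_prop
  have hch1 : ∀ v, ‖ch v‖ = 1 := fun v => Circle.norm_coe _
  have hF : 𝓕 (fun v => (k v : ℂ)) ξ = ∫ v, (k v : ℂ) * ch v := by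
    rw [Real.fourier_eq]
    refine integral_congr_ae (Eventually.of_forall fun v => ?_)
    simp [hch, Circle.smul_def, mul_comm]
  have hkch : Integrable (fun v => (k v : ℂ) * ch v) :=
    hcint.mul_bdd (c := 1) hchc.aestronglyMeasurable (Eventually.of_forall fun v => (hch1 v).le)
  have hin : ‖∫ v in B, (k v : ℂ) * ch v‖ ≤ C * (2 * π * ‖ξ‖) * (c * 2 ^ (d + 1) * r) := by
    refine norm_setIntegral_closedBall_le_of_odd hV hk hodd hint hchc hr (by positivity) ?_
    intro v _
    have : ‖ch v - ch 0‖ ≤ ‖2 * π * inner ℝ v ξ‖ := by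
      have h := Real.norm_exp_I_mul_ofReal_sub_one_le (x := 2 * π * -inner ℝ v ξ)
      rw [show ‖2 * π * inner ℝ v ξ‖ = ‖2 * π * -inner ℝ v ξ‖ by rw [mul_neg, norm_neg]]
      simp only [hch, Real.fourierChar_apply, inner_zero_left, neg_zero, mul_zero,
        Complex.ofReal_zero, zero_mul, Complex.exp_zero]
      rwa [mul_comm _ Complex.I]
    refine this.trans ?_
    rw [norm_mul, norm_mul]
    have := abs_real_inner_le_norm v ξ
    simp only [Real.norm_eq_abs, abs_of_pos pi_pos, abs_two]
    nlinarith [pi_pos]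
  set k1 : V → ℂ := Bᶜ.indicator (fun v => (k v : ℂ)) with hk1
  have hk1int : Integrable k1 := hcint.indicator hB.compl
  have hk1ch : Integrable (fun v => k1 v * ch v) :=
    hk1int.mul_bdd (c := 1) hchc.aestronglyMeasurable (Eventually.of_forall fun v => (hch1 v).le)
  set J : ℂ := ∫ v, k1 v * ch v with hJ
  have hout : ∫ v in Bᶜ, (k v : ℂ) * ch v = J := by
    rw [← integral_indicator hB.compl, hJ]
    congr 1; ext v
    by_cases hv : v ∈ Bᶜ
    · simp [hk1, Set.indicator_of_mem hv]
    · simp [hk1, Set.indicator_of_notMem hv]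
  set z : V := (r / (2 * ‖ξ‖)) • ξ with hz
  have hzn : ‖z‖ = r / 2 := by
    rw [hz, norm_smul, Real.norm_eq_abs, abs_of_pos (by positivity)]
    field_simp
  have hzch : ∀ v, ch (v + z) = - ch v := by
    intro v
    have h1 : inner ℝ z ξ = 1 / 2 := by
      rw [hz, inner_smul_left, real_inner_self_eq_norm_sq, hr_def]
      simp
      field_simp
    simp only [hch, inner_add_left, h1, Real.fourierChar_apply]
    rw [show ((2 * π * -(inner ℝ v ξ + 1 / 2) : ℝ) : ℂ) * Complex.I
      = ((2 * π * -(inner ℝ v ξ) : ℝ) : ℂ) * Complex.I - π * Complex.I by push_cast; ring,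
      Complex.exp_sub, Complex.exp_pi_mul_I, div_neg, div_one]
  have hJ' : ∫ v, k1 (v - z) * ch v = -J := by
    rw [← integral_add_right_eq_self (fun v => k1 (v - z) * ch v) z]
    simp [hzch, hJ, integral_neg]
  have hk1z : Integrable (fun v => k1 (v - z) * ch v) :=
    (hk1int.comp_sub_right z).mul_bdd (c := 1) hchc.aestronglyMeasurable
      (Eventually.of_forall fun v => (hch1 v).le)
  have h2J : 2 * J = ∫ v, (k1 v - k1 (v - z)) * ch v := by
    simp_rw [sub_mul]
    rw [integral_sub hk1ch hk1z, hJ', ← hJ]; ring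
  have hk1b : ∀ v, ‖k1 v‖ ≤ C / r ^ d := by
    intro v
    by_cases hv : v ∈ Bᶜ
    · simp only [hk1, Set.indicator_of_mem hv, Complex.norm_real, Real.norm_eq_abs]
      refine hk.abs_le hr ?_
      simp [hB_def] at hv; exact hv.le
    · simp only [hk1, Set.indicator_of_notMem hv, norm_zero]; positivity
  have hdiff : ∀ v, ‖(k1 v - k1 (v - z)) * ch v‖
      ≤ (2 * 3 ^ (d + 1) * C) * (r / (r + dist 0 v) ^ (d + 1)) := by
    intro v
    rw [norm_mul, hch1, mul_one, dist_zero_left]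
    have hvn := norm_nonneg v
    rcases le_or_gt ‖v‖ (2 * r) with hv | hv
    · calc ‖k1 v - k1 (v - z)‖ ≤ C / r ^ d + C / r ^ d :=
            (norm_sub_le _ _).trans (add_le_add (hk1b _) (hk1b _))
        _ = (2 * 3 ^ (d + 1) * C) * (r / (3 * r) ^ (d + 1)) := by
            rw [mul_pow]; field_simp; ring
        _ ≤ _ := by gcongr; linarith
    · have h1 : v ∈ Bᶜ := by simp [hB_def]; linarith
      have h2 : v - z ∈ Bᶜ := by
        have := norm_sub_norm_le v z
        simp [hB_def]; linarith
      simp only [hk1, Set.indicator_of_mem h1, Set.indicator_of_mem h2]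
      rw [← Complex.ofReal_sub, Complex.norm_real, Real.norm_eq_abs]
      have hvp : 0 < ‖v‖ := by linarith
      calc |k v - k (v - z)| ≤ C * r / ((r + ‖v‖) / 3) ^ (d + 1) := by
            refine hk.abs_sub_le (by positivity) (by linarith) ?_ (by linarith)
            simp [hzn]; linarith
        _ = 3 ^ (d + 1) * C * (r / (r + ‖v‖) ^ (d + 1)) := by
            rw [div_pow]; field_simp
        _ ≤ _ := by
            gcongr
            nlinarith [pow_pos (show (0 : ℝ) < 3 by norm_num) (d + 1)]
  have hJb : ‖2 * J‖ ≤ (2 * 3 ^ (d + 1) * C) * (c * 2 ^ (d + 2)) := by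
    rw [h2J]
    exact norm_integral_le_of_lintegral_enorm_le (by positivity)
      (hV.lintegral_enorm_le_of_poisson hr (by positivity) hdiff)
  have hJb' : ‖J‖ ≤ 3 ^ (d + 1) * C * (c * 2 ^ (d + 2)) := by
    rw [norm_mul] at hJb; norm_num at hJb; linarith
  rw [hF, ← integral_add_compl hB hkch, hout]
  refine (norm_add_le _ _).trans ((add_le_add hin hJb').trans ?_)
  have e1 : C * (2 * π * ‖ξ‖) * (c * 2 ^ (d + 1) * r) = C * c * (2 * π * 2 ^ (d + 1)) := by
    rw [hr_def]; field_simp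
  have e2 : (2 : ℝ) ^ (d + 1) ≤ 6 ^ (d + 1) := by gcongr; norm_num
  have e3 : (3 : ℝ) ^ (d + 1) * 2 ^ (d + 2) = 2 * 6 ^ (d + 1) := by
    rw [show (6 : ℝ) = 3 * 2 by norm_num, mul_pow]; ring
  have e4 : (6 : ℝ) ^ (d + 4) = 216 * 6 ^ (d + 1) := by ring
  have e5 := pi_lt_four
  have e6 : 2 * π * 2 ^ (d + 1) ≤ 8 * 6 ^ (d + 1) := by
    gcongr; linarith
  rw [e1, show 3 ^ (d + 1) * C * (c * 2 ^ (d + 2)) = C * c * (3 ^ (d + 1) * 2 ^ (d + 2)) by ring,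
    e3, ← mul_add, ← mul_assoc, e4]
  have : (0 : ℝ) < 6 ^ (d + 1) := by positivity
  gcongr
  linarith

end Kernel

section Bilinear

theorem lintegral_enorm_mul_enorm_le {X : Type*} [MeasurableSpace X] {μ : Measure X} {f g : X → ℂ}
    (hf : AEStronglyMeasurable f μ) (hg : AEStronglyMeasurable g μ) :
    ∫⁻ x, ‖f x‖ₑ * ‖g x‖ₑ ∂μ ≤ eLpNorm f 2 μ * eLpNorm g 2 μ := by
  have := ENNReal.lintegral_mul_le_Lp_mul_Lq μ Real.HolderConjugate.two_two hf.enorm hg.enorm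
  rw [eLpNorm_eq_lintegral_rpow_enorm_toReal two_ne_zero ENNReal.ofNat_ne_top,
    eLpNorm_eq_lintegral_rpow_enorm_toReal two_ne_zero ENNReal.ofNat_ne_top]
  simpa using this

variable {V : Type*} [NormedAddCommGroup V] [InnerProductSpace ℝ V] [FiniteDimensional ℝ V]
  [MeasurableSpace V] [BorelSpace V]

theorem lintegral_bilinear_le {k f g : V → ℂ} (hk : Measurable k) (hf : Measurable f)
    (hg : Measurable g) :
    ∫⁻ w : V × V, ‖k (w.1 - w.2) * f w.1 * g w.2‖ₑ
      ≤ (∫⁻ v, ‖k v‖ₑ) * (eLpNorm f 2 volume * eLpNorm g 2 volume) := by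
  have hm : Measurable fun w : V × V => ‖k (w.1 - w.2) * f w.1 * g w.2‖ₑ := by fun_prop
  rw [Measure.volume_eq_prod, lintegral_prod_symm _ hm.aemeasurable]
  calc ∫⁻ q, ∫⁻ p, ‖k (p - q) * f p * g q‖ₑ
      = ∫⁻ q, ∫⁻ v, ‖k v * f (v + q) * g q‖ₑ := by
        refine lintegral_congr fun q => ?_
        rw [← lintegral_add_right_eq_self (fun p => ‖k (p - q) * f p * g q‖ₑ) q]
        simp
    _ = ∫⁻ v, ∫⁻ q, ‖k v * f (v + q) * g q‖ₑ := by
        refine lintegral_lintegral_swap (Measurable.aemeasurable ?_)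
        fun_prop
    _ ≤ ∫⁻ v, ‖k v‖ₑ * (eLpNorm f 2 volume * eLpNorm g 2 volume) := by
        refine lintegral_mono fun v => ?_
        simp only [enorm_mul, mul_assoc]
        rw [lintegral_const_mul _ (by fun_prop)]
        gcongr
        have hmp := measurePreserving_add_left (volume : Measure V) v
        rw [← eLpNorm_comp_measurePreserving hf.aestronglyMeasurable hmp]
        exact lintegral_enorm_mul_enorm_le (hf.comp (measurable_const_add v)).aestronglyMeasurable
          hg.aestronglyMeasurable
    _ = _ := by rw [lintegral_mul_const _ (by fun_prop)]

theorem integrable_bilinear {k f g : V → ℂ} (hk : Integrable k) (hkm : Measurable k)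
    (hf : Measurable f) (hg : Measurable g) (hf2 : MemLp f 2 volume) (hg2 : MemLp g 2 volume) :
    Integrable fun w : V × V => k (w.1 - w.2) * f w.1 * g w.2 :=
  ⟨Measurable.aestronglyMeasurable (by fun_prop), (lintegral_bilinear_le hkm hf hg).trans_lt
    (ENNReal.mul_lt_top hk.2 (ENNReal.mul_lt_top hf2.2 hg2.2))⟩

open FourierTransform in
theorem integral_mul_fourier_eq {h u : V → ℂ} (hh : Integrable h) (hu : Integrable u) :
    ∫ p, h p * 𝓕 u p = ∫ ξ, 𝓕 h ξ * u ξ := by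
  have := VectorFourier.integral_bilin_fourierIntegral_eq_flip (ContinuousLinearMap.mul ℂ ℂ)
    (L := innerₗ V) (μ := volume) (ν := volume) Real.continuous_fourierChar continuous_inner
    hh hu
  simpa using! this.symm

open FourierTransform SchwartzMap in
theorem eLpNorm_fourier_schwartz (u : 𝓢(V, ℂ)) :
    eLpNorm (𝓕 (u : V → ℂ)) 2 volume = eLpNorm u 2 volume := by
  have := norm_fourier_toL2_eq u
  rw [norm_toLp, norm_toLp, ENNReal.toReal_eq_toReal_iff' ((𝓕 u).memLp 2 volume).2.ne
    (u.memLp 2 volume).2.ne, fourier_coe] at this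
  exact this

open FourierTransform Convolution SchwartzMap in
theorem norm_bilinear_schwartz_le {k : V → ℂ} (hk : Integrable k) (hkm : Measurable k) {M : ℝ}
    (hM : ∀ ξ, ‖𝓕 k ξ‖ ≤ M) (f g : 𝓢(V, ℂ)) :
    ‖∫ w : V × V, k (w.1 - w.2) * f w.1 * g w.2‖ₑ
      ≤ ENNReal.ofReal M * (eLpNorm f 2 volume * eLpNorm g 2 volume) := by
  have hint := integrable_bilinear hk hkm f.continuous.measurable g.continuous.measurable
    (f.memLp 2 volume) (g.memLp 2 volume)
  obtain ⟨h, hh⟩ : ∃ h : V → ℂ, h = (g : V → ℂ) ⋆[ContinuousLinearMap.mul ℂ ℂ] k := ⟨_, rfl⟩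
  have hhint : Integrable h := hh ▸ g.integrable.integrable_convolution _ hk
  have h1 : ∫ w : V × V, k (w.1 - w.2) * f w.1 * g w.2 = ∫ p, h p * f p := by
    rw [Measure.volume_eq_prod] at hint ⊢
    rw [integral_prod _ hint]
    refine integral_congr_ae (Eventually.of_forall fun p => ?_)
    simp only [hh, convolution_def, ContinuousLinearMap.mul_apply']
    rw [← integral_mul_const]
    exact integral_congr_ae (Eventually.of_forall fun q => by ring)
  obtain ⟨F, hF⟩ : ∃ F : 𝓢(V, ℂ), 𝓕 (F : V → ℂ) = f :=
    ⟨𝓕⁻ f, by rw [← fourier_coe, FourierTransform.fourier_fourierInv_eq]⟩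
  have hFn : eLpNorm F 2 volume = eLpNorm f 2 volume := by rw [← hF, eLpNorm_fourier_schwartz]
  have h2 : ∫ p, h p * f p = ∫ ξ, 𝓕 h ξ * F ξ := by
    rw [← hF, integral_mul_fourier_eq hhint F.integrable]
  have h3 : ∀ ξ, 𝓕 h ξ = 𝓕 (g : V → ℂ) ξ * 𝓕 k ξ := fun ξ =>
    hh ▸ Real.fourier_mul_convolution_eq g.integrable hk ξ
  have hgm : AEStronglyMeasurable (𝓕 (g : V → ℂ)) volume := by
    rw [← fourier_coe]; exact (𝓕 g).continuous.aestronglyMeasurable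
  rw [h1, h2, ← hFn, ← eLpNorm_fourier_schwartz g]
  calc ‖∫ ξ, 𝓕 h ξ * F ξ‖ₑ ≤ ∫⁻ ξ, ‖𝓕 h ξ * F ξ‖ₑ := enorm_integral_le_lintegral_enorm _
    _ ≤ ∫⁻ ξ, ENNReal.ofReal M * (‖F ξ‖ₑ * ‖𝓕 (g : V → ℂ) ξ‖ₑ) := by
        refine lintegral_mono fun ξ => ?_
        have : ‖𝓕 k ξ‖ₑ ≤ ENNReal.ofReal M := by
          rw [← ofReal_norm]; exact ENNReal.ofReal_le_ofReal (hM ξ)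
        calc ‖𝓕 h ξ * F ξ‖ₑ = ‖𝓕 k ξ‖ₑ * (‖F ξ‖ₑ * ‖𝓕 (g : V → ℂ) ξ‖ₑ) := by
              rw [h3, enorm_mul, enorm_mul]; ring
          _ ≤ _ := by gcongr
    _ = ENNReal.ofReal M * ∫⁻ ξ, ‖F ξ‖ₑ * ‖𝓕 (g : V → ℂ) ξ‖ₑ :=
        lintegral_const_mul' _ _ ENNReal.ofReal_ne_top
    _ ≤ ENNReal.ofReal M * (eLpNorm F 2 volume * eLpNorm (𝓕 (g : V → ℂ)) 2 volume) := by
        gcongr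
        exact lintegral_enorm_mul_enorm_le F.continuous.aestronglyMeasurable hgm

open FourierTransform in
/-- `L²`-boundedness of the bilinear form of a convolution kernel with bounded Fourier
transform. -/
theorem enorm_bilinear_le {k : V → ℂ} (hk : Integrable k) (hkm : Measurable k) {M : ℝ}
    (hM : ∀ ξ, ‖𝓕 k ξ‖ ≤ M) {f g : V → ℂ} (hf : Measurable f) (hg : Measurable g)
    (hf2 : MemLp f 2 volume) (hg2 : MemLp g 2 volume) :
    ‖∫ w : V × V, k (w.1 - w.2) * f w.1 * g w.2‖ₑ
      ≤ ENNReal.ofReal M * (eLpNorm f 2 volume * eLpNorm g 2 volume) := by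
  set I := ∫⁻ v, ‖k v‖ₑ with hI
  set a := eLpNorm f 2 volume with ha
  set b := eLpNorm g 2 volume with hb
  have hIt : I ≠ ⊤ := hk.2.ne
  have hat : a ≠ ⊤ := hf2.2.ne
  have hbt : b ≠ ⊤ := hg2.2.ne
  have approx : ∀ δ : ℝ, 0 < δ → ‖∫ w : V × V, k (w.1 - w.2) * f w.1 * g w.2‖ₑ ≤
      I * (ENNReal.ofReal δ * b) + I * ((a + ENNReal.ofReal δ) * ENNReal.ofReal δ)
        + ENNReal.ofReal M * ((a + ENNReal.ofReal δ) * (b + ENNReal.ofReal δ)) := by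
    intro δ hδ
    obtain ⟨f', hf'c, hf's, hf'⟩ := hf2.exist_eLpNorm_sub_le ENNReal.ofNat_ne_top one_le_two hδ
    obtain ⟨g', hg'c, hg's, hg'⟩ := hg2.exist_eLpNorm_sub_le ENNReal.ofNat_ne_top one_le_two hδ
    have hf'm := hf's.continuous.measurable
    have hg'm := hg's.continuous.measurable
    have hf'2 : MemLp f' 2 volume := hf's.continuous.memLp_of_hasCompactSupport hf'c
    have hg'2 : MemLp g' 2 volume := hg's.continuous.memLp_of_hasCompactSupport hg'c
    have hle : ∀ {u u' : V → ℂ}, Measurable u → Measurable u' →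
        eLpNorm (u - u') 2 volume ≤ ENNReal.ofReal δ →
        eLpNorm u' 2 volume ≤ eLpNorm u 2 volume + ENNReal.ofReal δ := by
      intro u u' hu hu' h
      calc eLpNorm u' 2 volume = eLpNorm (u - (u - u')) 2 volume := by simp
        _ ≤ eLpNorm u 2 volume + eLpNorm (u - u') 2 volume :=
            eLpNorm_sub_le hu.aestronglyMeasurable (hu.sub hu').aestronglyMeasurable one_le_two
        _ ≤ _ := by gcongr
    have e : ∫ w : V × V, k (w.1 - w.2) * f w.1 * g w.2
        = (∫ w : V × V, k (w.1 - w.2) * (f - f') w.1 * g w.2)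
          + (∫ w : V × V, k (w.1 - w.2) * f' w.1 * (g - g') w.2)
          + ∫ w : V × V, k (w.1 - w.2) * f' w.1 * g' w.2 := by
      have i1 := integrable_bilinear hk hkm (hf.sub hf'm) hg (hf2.sub hf'2) hg2
      have i2 := integrable_bilinear hk hkm hf'm (hg.sub hg'm) hf'2 (hg2.sub hg'2)
      have i3 := integrable_bilinear hk hkm hf'm hg'm hf'2 hg'2
      refine (integral_congr_ae (Eventually.of_forall fun w => ?_)).trans
        ((integral_add (i1.add i2) i3).trans (congrArg (· + _) (integral_add i1 i2)))
      simp only [Pi.sub_apply, Pi.add_apply]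
      ring
    rw [e]
    refine (enorm_add_le _ _).trans (add_le_add ((enorm_add_le _ _).trans (add_le_add ?_ ?_)) ?_)
    · refine (enorm_integral_le_lintegral_enorm _).trans
        ((lintegral_bilinear_le hkm (hf.sub hf'm) hg).trans ?_)
      gcongr
    · refine (enorm_integral_le_lintegral_enorm _).trans
        ((lintegral_bilinear_le hkm hf'm (hg.sub hg'm)).trans ?_)
      gcongr
      exact hle hf hf'm hf'
    · refine (norm_bilinear_schwartz_le hk hkm hM (hf'c.toSchwartzMap hf's)
        (hg'c.toSchwartzMap hg's)).trans ?_
      gcongr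
      · exact hle hf hf'm hf'
      · exact hle hg hg'm hg'
  have hlim : Tendsto (fun δ : ℝ => I * (ENNReal.ofReal δ * b)
      + I * ((a + ENNReal.ofReal δ) * ENNReal.ofReal δ)
        + ENNReal.ofReal M * ((a + ENNReal.ofReal δ) * (b + ENNReal.ofReal δ))) (𝓝[>] 0)
      (𝓝 (I * (0 * b) + I * ((a + 0) * 0) + ENNReal.ofReal M * ((a + 0) * (b + 0)))) := by
    have h0 : Tendsto (fun δ : ℝ => ENNReal.ofReal δ) (𝓝[>] 0) (𝓝 0) := by
      have := tendsto_nhdsWithin_of_tendsto_nhds (s := Ioi 0) (ENNReal.continuous_ofReal.tendsto 0)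
      simpa using this
    have h1 : Tendsto (fun δ : ℝ => a + ENNReal.ofReal δ) (𝓝[>] 0) (𝓝 (a + 0)) :=
      tendsto_const_nhds.add h0
    have h2 : Tendsto (fun δ : ℝ => b + ENNReal.ofReal δ) (𝓝[>] 0) (𝓝 (b + 0)) :=
      tendsto_const_nhds.add h0
    refine ((ENNReal.Tendsto.const_mul ?_ (Or.inr hIt)).add
      (ENNReal.Tendsto.const_mul ?_ (Or.inr hIt))).add
      (ENNReal.Tendsto.const_mul ?_ (Or.inr ENNReal.ofReal_ne_top))
    · exact ENNReal.Tendsto.mul h0 (Or.inr hbt) tendsto_const_nhds (Or.inr ENNReal.zero_ne_top)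
    · exact ENNReal.Tendsto.mul h1 (Or.inr ENNReal.zero_ne_top) h0 (Or.inr (by simpa using hat))
    · exact ENNReal.Tendsto.mul h1 (Or.inr (by simpa using hbt)) h2 (Or.inr (by simpa using hat))
  have := ge_of_tendsto hlim (eventually_nhdsWithin_of_forall fun δ hδ => approx δ hδ)
  simpa using this

end Bilinear

section Kernel

variable {E : Type*} [NormedAddCommGroup E]

theorem isCZ_of_norm_fderiv_le [NormedSpace ℝ E] {K : E → ℝ} {d : ℕ} (hd : d ≠ 0) {C₀ C₁ : ℝ}
    (hC₀ : 0 ≤ C₀) (hC₁ : 0 ≤ C₁) (hdiff : ∀ x ≠ 0, DifferentiableAt ℝ K x)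
    (hsize : ∀ x ≠ 0, |K x| * ‖x‖ ^ d ≤ C₀)
    (hgrad : ∀ x ≠ 0, ‖fderiv ℝ K x‖ * ‖x‖ ^ (d + 1) ≤ C₁) :
    IsCZ K d (C₀ + C₁ * 2 ^ (d + 1)) where
  size u := by
    have : 0 ≤ C₁ * 2 ^ (d + 1) := by positivity
    rcases eq_or_ne u 0 with rfl | hu
    · simp only [norm_zero, zero_pow hd, mul_zero]; linarith
    · linarith [hsize u hu]
  smooth u w h := by
    rcases eq_or_ne u 0 with rfl | hu
    · have : w = 0 := by simpa using h
      simp [this]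
    have hu' : 0 < ‖u‖ := norm_pos_iff.2 hu
    have hball : ∀ x ∈ closedBall u (‖u‖ / 2), ‖u‖ / 2 ≤ ‖x‖ := by
      intro x hx
      rw [mem_closedBall, dist_eq_norm, norm_sub_rev] at hx
      linarith [norm_sub_norm_le u x]
    have hne : ∀ x ∈ closedBall u (‖u‖ / 2), x ≠ 0 := fun x hx =>
      norm_pos_iff.1 ((half_pos hu').trans_le (hball x hx))
    have key := (convex_closedBall u (‖u‖ / 2)).norm_image_sub_le_of_norm_fderiv_le (𝕜 := ℝ)
      (f := K) (C := C₁ / (‖u‖ / 2) ^ (d + 1)) (fun x hx => hdiff x (hne x hx))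
      (fun x hx => by
        rw [le_div_iff₀ (by positivity)]
        refine le_trans ?_ (hgrad x (hne x hx))
        gcongr
        exact hball x hx)
      (x := u) (y := w) (mem_closedBall_self (by positivity))
      (by rwa [mem_closedBall, dist_eq_norm, norm_sub_rev])
    rw [Real.norm_eq_abs, abs_sub_comm, norm_sub_rev] at key
    calc |K u - K w| * ‖u‖ ^ (d + 1)
        ≤ C₁ / (‖u‖ / 2) ^ (d + 1) * ‖u - w‖ * ‖u‖ ^ (d + 1) := by gcongr
      _ = C₁ * 2 ^ (d + 1) * ‖u - w‖ := by rw [div_pow]; field_simp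
      _ ≤ _ := by gcongr; linarith

/-- A Lipschitz cutoff, equal to `1` on the unit ball and supported in the ball of radius `2`. -/
def cutoff (x : E) : ℝ := max 0 (min 1 (2 - ‖x‖))

theorem continuous_cutoff : Continuous (cutoff : E → ℝ) := by unfold cutoff; fun_prop

theorem cutoff_nonneg (x : E) : 0 ≤ cutoff x := le_max_left _ _

theorem cutoff_le_one (x : E) : cutoff x ≤ 1 := max_le zero_le_one (min_le_left _ _)

theorem cutoff_eq_zero {x : E} (hx : 2 ≤ ‖x‖) : cutoff x = 0 :=
  max_eq_left ((min_le_right _ _).trans (by linarith))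

theorem cutoff_eq_one {x : E} (hx : ‖x‖ ≤ 1) : cutoff x = 1 := by
  rw [cutoff, min_eq_left (by linarith), max_eq_right zero_le_one]

theorem abs_cutoff_sub_le (x y : E) : |cutoff x - cutoff y| ≤ ‖x - y‖ := by
  refine le_trans ?_ (abs_norm_sub_norm_le x y)
  refine (abs_max_sub_max_le_max _ _ _ _).trans (max_le (by simp) ?_)
  refine (abs_min_sub_min_le_max _ _ _ _).trans (max_le (by simp) ?_)
  rw [abs_sub_comm]
  exact le_of_eq (congrArg _ (by ring))

theorem IsCZ.mul_cutoff {K : E → ℝ} {d : ℕ} {C : ℝ} (hK : IsCZ K d C) :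
    IsCZ (fun x => K x * cutoff x) d (C * (1 + 2 ^ (d + 2))) where
  size u := by
    have hC := hK.nonneg
    rw [abs_mul, abs_of_nonneg (cutoff_nonneg u)]
    calc |K u| * cutoff u * ‖u‖ ^ d ≤ |K u| * 1 * ‖u‖ ^ d := by gcongr; exact cutoff_le_one u
      _ ≤ C := by simpa using hK.size u
      _ ≤ _ := le_mul_of_one_le_right hC (by linarith [show (0:ℝ) ≤ 2 ^ (d + 2) by positivity])
  smooth u w h := by
    have hC := hK.nonneg
    have hw : ‖u‖ / 2 ≤ ‖w‖ := by linarith [norm_sub_norm_le u w]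
    have h1 : |cutoff u - cutoff w| * ‖u‖ ≤ 4 * ‖u - w‖ := by
      rcases le_total ‖u‖ 4 with h4 | h4
      · rw [mul_comm]
        gcongr
        exact abs_cutoff_sub_le u w
      · rw [cutoff_eq_zero (by linarith), cutoff_eq_zero (by linarith)]
        simp
    have h2 : |K w| * ‖u‖ ^ d ≤ 2 ^ d * C := by
      calc |K w| * ‖u‖ ^ d ≤ |K w| * (2 * ‖w‖) ^ d := by gcongr; linarith
        _ = 2 ^ d * (|K w| * ‖w‖ ^ d) := by rw [mul_pow]; ring
        _ ≤ _ := by gcongr; exact hK.size w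
    have h3 : |K u * cutoff u - K w * cutoff w|
        ≤ |K u - K w| * 1 + |K w| * |cutoff u - cutoff w| := by
      calc |K u * cutoff u - K w * cutoff w|
          = |(K u - K w) * cutoff u + K w * (cutoff u - cutoff w)| := by ring_nf
        _ ≤ |K u - K w| * |cutoff u| + |K w| * |cutoff u - cutoff w| := by
            rw [← abs_mul, ← abs_mul]; exact abs_add_le _ _
        _ ≤ _ := by gcongr; rw [abs_of_nonneg (cutoff_nonneg u)]; exact cutoff_le_one u
    calc |K u * cutoff u - K w * cutoff w| * ‖u‖ ^ (d + 1)
        ≤ (|K u - K w| * 1 + |K w| * |cutoff u - cutoff w|) * ‖u‖ ^ (d + 1) := by gcongr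
      _ = |K u - K w| * ‖u‖ ^ (d + 1)
          + (|K w| * ‖u‖ ^ d) * (|cutoff u - cutoff w| * ‖u‖) := by ring
      _ ≤ C * ‖u - w‖ + (2 ^ d * C) * (4 * ‖u - w‖) := by
          have := hK.smooth u w h
          gcongr
      _ = _ := by ring

theorem IsCZ.abs_sub_mul_cutoff_le {K : E → ℝ} {d : ℕ} {C : ℝ} (hK : IsCZ K d C) (u : E) :
    |K u - K u * cutoff u| ≤ C := by
  rcases le_total ‖u‖ 1 with h | h
  · simpa [cutoff_eq_one h] using hK.nonneg
  · have := hK.abs_le one_pos h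
    calc |K u - K u * cutoff u| = |K u| * |1 - cutoff u| := by rw [← abs_mul]; ring_nf
      _ ≤ C / 1 ^ d * 1 := by
          gcongr
          · exact (abs_nonneg _).trans this
          · rw [abs_of_nonneg (by linarith [cutoff_le_one u])]; linarith [cutoff_nonneg u]
      _ = C := by simp

end Kernel

section Slice

variable {V F : Type*} [NormedAddCommGroup V] [InnerProductSpace ℝ V]
  [NormedAddCommGroup F] [InnerProductSpace ℝ F]

/-- `J` and `p` present `F` as the orthogonal sum of `V` and the line spanned by the unit
vector `e`. -/
structure IsSlicing (J : V →ₗᵢ[ℝ] F) (p : F →L[ℝ] V) (e : F) : Prop where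
  norm_e : ‖e‖ = 1
  inner_e (v : V) : inner ℝ e (J v) = 0
  decomp (x : F) : J (p x) + inner ℝ e x • e = x

variable {J : V →ₗᵢ[ℝ] F} {p : F →L[ℝ] V} {e : F}

theorem IsSlicing.norm_sq (h : IsSlicing J p e) (v : V) (a : ℝ) :
    ‖J v + a • e‖ ^ 2 = ‖v‖ ^ 2 + a ^ 2 := by
  rw [norm_add_sq_real, inner_smul_right, real_inner_comm, h.inner_e, norm_smul, h.norm_e]
  simp

theorem IsSlicing.norm_le (h : IsSlicing J p e) (v : V) (a : ℝ) : ‖v‖ ≤ ‖J v + a • e‖ :=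
  le_of_sq_le_sq (by rw [h.norm_sq]; nlinarith) (norm_nonneg _)

theorem IsSlicing.abs_le (h : IsSlicing J p e) (v : V) (a : ℝ) : |a| ≤ ‖J v + a • e‖ :=
  abs_le_of_sq_le_sq (by rw [h.norm_sq]; nlinarith [sq_nonneg ‖v‖]) (norm_nonneg _)

/-- The average of the restrictions of `K` to two parallel hyperplanes. -/
def slice (J : V →ₗᵢ[ℝ] F) (e : F) (K : F → ℝ) (ε : ℝ) (v : V) : ℝ :=
  (K (J v + ε • e) + K (J v - ε • e)) / 2

theorem IsSlicing.isCZ_slice (h : IsSlicing J p e) {K : F → ℝ} {d : ℕ} {C : ℝ} (hK : IsCZ K d C)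
    (ε : ℝ) : IsCZ (slice J e K ε) d C where
  size u := by
    have h1 : ∀ a : ℝ, |K (J u + a • e)| * ‖u‖ ^ d ≤ C := fun a => by
      refine le_trans ?_ (hK.size (J u + a • e))
      gcongr
      exact h.norm_le u a
    have h2 := h1 (-ε)
    rw [neg_smul, ← sub_eq_add_neg] at h2
    rw [slice, abs_div, abs_two]
    calc |K (J u + ε • e) + K (J u - ε • e)| / 2 * ‖u‖ ^ d
        ≤ (|K (J u + ε • e)| + |K (J u - ε • e)|) / 2 * ‖u‖ ^ d := by gcongr; exact abs_add_le _ _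
      _ ≤ C := by linarith [h1 ε]
  smooth u w huw := by
    have h1 : ∀ a : ℝ, |K (J u + a • e) - K (J w + a • e)| * ‖u‖ ^ (d + 1) ≤ C * ‖u - w‖ :=
      fun a => by
        have e1 : ‖J u + a • e - (J w + a • e)‖ = ‖u - w‖ := by
          rw [add_sub_add_right_eq_sub, ← map_sub, J.norm_map]
        have := hK.smooth (J u + a • e) (J w + a • e) (by rw [e1]; linarith [h.norm_le u a])
        rw [e1] at this
        refine le_trans ?_ this
        gcongr
        exact h.norm_le u a
    have h2 := h1 (-ε)
    rw [neg_smul, ← sub_eq_add_neg, ← sub_eq_add_neg] at h2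
    calc |slice J e K ε u - slice J e K ε w| * ‖u‖ ^ (d + 1)
        = |(K (J u + ε • e) - K (J w + ε • e)) + (K (J u - ε • e) - K (J w - ε • e))| / 2
            * ‖u‖ ^ (d + 1) := by
          have : slice J e K ε u - slice J e K ε w = ((K (J u + ε • e) - K (J w + ε • e))
              + (K (J u - ε • e) - K (J w - ε • e))) / 2 := by rw [slice, slice]; ring
          rw [this, abs_div, abs_two]
      _ ≤ (|K (J u + ε • e) - K (J w + ε • e)| + |K (J u - ε • e) - K (J w - ε • e)|) / 2
            * ‖u‖ ^ (d + 1) := by gcongr; exact abs_add_le _ _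
      _ ≤ C * ‖u - w‖ := by linarith [h1 ε]

theorem slice_neg {K : F → ℝ} (hodd : ∀ x, K (-x) = -K x) (ε : ℝ) (v : V) :
    slice J e K ε (-v) = -slice J e K ε v := by
  have e1 : -J v + ε • e = -(J v - ε • e) := by abel
  have e2 : -J v - ε • e = -(J v + ε • e) := by abel
  rw [slice, slice, map_neg, e1, e2, hodd, hodd]
  ring

theorem IsSlicing.continuous_slice (h : IsSlicing J p e) {K : F → ℝ}
    (hK : ContinuousOn K {0}ᶜ) {ε : ℝ} (hε : 0 < ε) : Continuous (slice J e K ε) := by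
  have h1 : ∀ a : ℝ, a ≠ 0 → Continuous fun v : V => K (J v + a • e) := fun a ha => by
    refine hK.comp_continuous (by have := J.continuous; fun_prop) fun v hv => ha ?_
    have := h.abs_le v a
    rw [show J v + a • e = 0 from hv, norm_zero] at this
    exact abs_nonpos_iff.1 this
  have h2 := h1 (-ε) (by linarith)
  simp only [neg_smul, ← sub_eq_add_neg] at h2
  exact ((h1 ε hε.ne').add h2).div_const 2

theorem IsSlicing.integrable_slice_cutoff [FiniteDimensional ℝ V] [MeasurableSpace V]
    [BorelSpace V] (h : IsSlicing J p e) {K : F → ℝ}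
    (hK : ContinuousOn K {0}ᶜ) {ε : ℝ} (hε : 0 < ε) :
    Integrable (slice J e (fun x => K x * cutoff x) ε) := by
  refine (h.continuous_slice (hK.mul continuous_cutoff.continuousOn)
    hε).integrable_of_hasCompactSupport (HasCompactSupport.of_support_subset_isCompact
      (isCompact_closedBall (0 : V) 2) fun v hv => ?_)
  contrapose! hv
  have hv : 2 < ‖v‖ := by simpa using hv
  have h2 := h.norm_le v (-ε)
  rw [neg_smul, ← sub_eq_add_neg] at h2
  simp only [Function.mem_support, not_not, slice, Pi.mul_apply]
  rw [cutoff_eq_zero (hv.le.trans (h.norm_le v ε)),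
    cutoff_eq_zero (hv.le.trans h2)]
  simp

end Slice

section Tent

variable {V : Type*} [NormedAddCommGroup V]

/-- An `L¹`-normalised bump of width `t`. -/
def tent (d : ℕ) (t : ℝ) (v : V) : ℝ := max 0 (1 - ‖v‖ / t) / t ^ d

theorem continuous_tent (d : ℕ) (t : ℝ) : Continuous (tent d t : V → ℝ) := by
  unfold tent; fun_prop

theorem tent_nonneg (d : ℕ) {t : ℝ} (ht : 0 < t) (v : V) : 0 ≤ tent d t v := by
  unfold tent; positivity

theorem tent_le (d : ℕ) {t : ℝ} (ht : 0 < t) (v : V) : tent d t v ≤ 1 / t ^ d := by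
  unfold tent
  gcongr
  exact max_le zero_le_one (by linarith [show 0 ≤ ‖v‖ / t by positivity])

theorem tent_eq_zero (d : ℕ) {t : ℝ} (ht : 0 < t) {v : V} (hv : t ≤ ‖v‖) : tent d t v = 0 := by
  have : 1 ≤ ‖v‖ / t := by rwa [one_le_div ht]
  rw [tent, max_eq_left (by linarith), zero_div]

theorem abs_tent_sub_le (d : ℕ) {t : ℝ} (ht : 0 < t) (v w : V) :
    |tent d t v - tent d t w| ≤ 1 / t ^ (d + 1) * ‖v - w‖ := by
  have h1 : |max 0 (1 - ‖v‖ / t) - max 0 (1 - ‖w‖ / t)| ≤ ‖v - w‖ / t := by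
    refine (abs_max_sub_max_le_max _ _ _ _).trans (max_le (by simp; positivity) ?_)
    rw [show 1 - ‖v‖ / t - (1 - ‖w‖ / t) = (‖w‖ - ‖v‖) / t by ring, abs_div, abs_of_pos ht,
      norm_sub_rev]
    gcongr
    exact abs_norm_sub_norm_le w v
  rw [tent, tent, ← sub_div, abs_div, abs_of_pos (pow_pos ht d)]
  calc _ ≤ ‖v - w‖ / t / t ^ d := by gcongr
    _ = _ := by rw [pow_succ]; field_simp

variable [InnerProductSpace ℝ V] [FiniteDimensional ℝ V]

theorem hasCompactSupport_tent (d : ℕ) {t : ℝ} (ht : 0 < t) :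
    HasCompactSupport (tent d t : V → ℝ) := by
  refine HasCompactSupport.of_support_subset_isCompact (isCompact_closedBall (0 : V) t)
    fun v hv => ?_
  contrapose! hv
  have hv : t < ‖v‖ := by simpa using hv
  exact Function.notMem_support.2 (tent_eq_zero d ht hv.le)

variable [MeasurableSpace V] [BorelSpace V]

theorem integrable_tent (d : ℕ) {t : ℝ} (ht : 0 < t) : Integrable (tent d t : V → ℝ) :=
  (continuous_tent d t).integrable_of_hasCompactSupport (hasCompactSupport_tent d ht)

/-- The common mass of the bumps `tent d t`, `t > 0`, in dimension `d`. -/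
def tentMass (V : Type*) [NormedAddCommGroup V] [InnerProductSpace ℝ V] [FiniteDimensional ℝ V]
    [MeasurableSpace V] [BorelSpace V] (d : ℕ) : ℝ := ∫ v : V, tent d 1 v

theorem integral_tent {d : ℕ} (hd : Module.finrank ℝ V = d) {t : ℝ} (ht : 0 < t) :
    ∫ v : V, tent d t v = tentMass V d := by
  have h1 : ∀ v : V, tent d t v = (t ^ d)⁻¹ * tent d 1 (t⁻¹ • v) := fun v => by
    rw [tent, tent, norm_smul, Real.norm_of_nonneg (by positivity)]
    rw [one_pow, div_one, div_one, inv_mul_eq_div, inv_mul_eq_div]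
  simp_rw [h1]
  rw [integral_const_mul, Measure.integral_comp_inv_smul, hd, abs_of_pos (by positivity),
    smul_eq_mul, ← mul_assoc, inv_mul_cancel₀ (by positivity), one_mul, tentMass]

theorem integral_tent_sub {d : ℕ} (hd : Module.finrank ℝ V = d) {t : ℝ} (ht : 0 < t) (a : V) :
    ∫ v : V, tent d t (v - a) = tentMass V d := by
  rw [integral_sub_right_eq_self (fun v : V => tent d t v) a, integral_tent hd ht]

theorem tentMass_pos (d : ℕ) : 0 < tentMass V d :=
  (continuous_tent d 1).integral_pos_of_hasCompactSupport_nonneg_nonzero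
    (hasCompactSupport_tent d one_pos) (fun v => tent_nonneg d one_pos v) (x := 0) (by simp [tent])

theorem tentMass_le {d : ℕ} {c : ℝ} (hV : HasGrowth (volume : Measure V) d c) :
    tentMass V d ≤ c := by
  have h1 := hV.le 0 1 one_pos
  have hc := hV.nonneg
  rw [one_pow, mul_one] at h1
  calc tentMass V d ≤ ∫ v : V, (closedBall (0 : V) 1).indicator (fun _ => (1 : ℝ)) v := by
        refine integral_mono (integrable_tent d one_pos) ?_ fun v => ?_
        · exact (integrable_indicator_iff isClosed_closedBall.measurableSet).2
            (integrableOn_const (h1.trans_lt ENNReal.ofReal_lt_top).ne)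
        · by_cases hv : v ∈ closedBall (0 : V) 1
          · simpa [hv] using tent_le d one_pos v
          · simp only [hv, not_false_eq_true, Set.indicator_of_notMem]
            exact (tent_eq_zero d one_pos (by simpa using (not_le.1 (by simpa using hv)).le)).le
    _ = volume.real (closedBall (0 : V) 1) := by
        rw [integral_indicator_const _ isClosed_closedBall.measurableSet]; simp
    _ ≤ c := ENNReal.toReal_le_of_le_ofReal hc h1

theorem abs_integral_mul_tent_le {k : V → ℝ} {d : ℕ} {c C : ℝ} (hd : Module.finrank ℝ V = d)
    (hV : HasGrowth (volume : Measure V) d c) (hk : IsCZ k d C) (hodd : ∀ u, k (-u) = -k u)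
    (hint : Integrable k) {t : ℝ} (ht : 0 < t) (u : V) :
    |∫ v, k v * tent d t (u - v)| ≤ C * (c * 2 ^ (d + 3)) / t ^ d := by
  have hC := hk.nonneg
  have hc := hV.nonneg
  rcases le_total ‖u‖ (2 * t) with hu | hu
  · have hsub : ∀ v, v ∉ closedBall (0 : V) (3 * t) → (k v : ℂ) * (tent d t (u - v) : ℂ) = 0 := by
      intro v hv
      have hv : 3 * t < ‖v‖ := by simpa using hv
      rw [tent_eq_zero d ht (by rw [norm_sub_rev]; linarith [norm_sub_norm_le v u])]
      simp
    have := norm_setIntegral_closedBall_le_of_odd hV hk hodd hint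
      (g := fun v => (tent d t (u - v) : ℂ)) (L := 1 / t ^ (d + 1)) (r := 3 * t)
      (by have := continuous_tent (V := V) d t; fun_prop) (by positivity) (by positivity)
      (fun v _ => by
        rw [← Complex.ofReal_sub, Complex.norm_real, Real.norm_eq_abs]
        refine (abs_tent_sub_le d ht _ _).trans_eq ?_
        rw [show u - v - (u - 0) = -v by abel, norm_neg])
    rw [setIntegral_eq_integral_of_forall_compl_eq_zero hsub] at this
    have e : ∫ v, (k v : ℂ) * (tent d t (u - v) : ℂ) = ((∫ v, k v * tent d t (u - v) : ℝ) : ℂ) := by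
      rw [← integral_complex_ofReal]; simp
    rw [e, Complex.norm_real, Real.norm_eq_abs] at this
    refine this.trans ?_
    rw [show C * (1 / t ^ (d + 1)) * (c * 2 ^ (d + 1) * (3 * t))
      = C * (c * (2 ^ (d + 1) * 3)) / t ^ d by rw [pow_succ t d]; field_simp]
    gcongr
    rw [pow_add 2 d 3, pow_add 2 d 1]
    linarith [show (0 : ℝ) ≤ 2 ^ d by positivity]
  · have hi : Integrable fun v => C / t ^ d * tent d t (u - v) :=
      ((integrable_tent d ht).comp_sub_left u).const_mul _
    calc |∫ v, k v * tent d t (u - v)| ≤ ∫ v, C / t ^ d * tent d t (u - v) := by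
          rw [← Real.norm_eq_abs]
          refine norm_integral_le_of_norm_le hi (Eventually.of_forall fun v => ?_)
          have h0 := tent_nonneg d ht (u - v)
          rw [norm_mul, Real.norm_of_nonneg h0]
          rcases le_total t ‖u - v‖ with h | h
          · simp [tent_eq_zero d ht h]
          · gcongr
            exact hk.abs_le ht (by linarith [norm_sub_norm_le u v])
      _ = C / t ^ d * tentMass V d := by
          rw [integral_const_mul, integral_sub_left_eq_self (fun v : V => tent d t v) volume u,
            integral_tent hd ht]
      _ ≤ C / t ^ d * c := by gcongr; exact tentMass_le hV
      _ ≤ _ := by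
          rw [div_mul_eq_mul_div]
          gcongr
          exact le_mul_of_one_le_right hc (one_le_pow₀ one_le_two)

/-- The kernel `k (w₁ - w₂)` on `V × V` tested against a pair of bumps. -/
def tentForm (d : ℕ) (k : V → ℝ) (σ θ : ℝ) (a b : V) : ℝ :=
  ∫ w : V × V, k (w.1 - w.2) * tent d σ (w.1 - a) * tent d θ (w.2 - b)

theorem memLp_tent_sub (d : ℕ) {t : ℝ} (ht : 0 < t) (a : V) :
    MemLp (fun v => (tent d t (v - a) : ℂ)) 2 volume :=
  ((continuous_tent d t).memLp_of_hasCompactSupport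
    (hasCompactSupport_tent d ht)).ofReal.comp_measurePreserving
      (measurePreserving_sub_right volume a)

theorem integrable_tentForm {d : ℕ} {k : V → ℝ} (hint : Integrable k) (hkm : Measurable k)
    {σ θ : ℝ} (hσ : 0 < σ) (hθ : 0 < θ) (a b : V) :
    Integrable fun w : V × V => k (w.1 - w.2) * tent d σ (w.1 - a) * tent d θ (w.2 - b) := by
  have := integrable_bilinear (k := fun v => (k v : ℂ)) hint.ofReal (by fun_prop)
    (f := fun v => (tent d σ (v - a) : ℂ)) (g := fun v => (tent d θ (v - b) : ℂ))
    (by have := (continuous_tent (V := V) d σ).measurable; fun_prop)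
    (by have := (continuous_tent (V := V) d θ).measurable; fun_prop)
    (memLp_tent_sub d hσ a) (memLp_tent_sub d hθ b)
  simpa using this.re

theorem tentForm_swap {d : ℕ} {k : V → ℝ} (hodd : ∀ u, k (-u) = -k u) (σ θ : ℝ) (a b : V) :
    tentForm d k θ σ b a = -tentForm d k σ θ a b := by
  rw [tentForm, tentForm, Measure.volume_eq_prod, ← integral_neg, ← integral_prod_swap]
  refine integral_congr_ae (Eventually.of_forall fun w => ?_)
  simp only [Prod.fst_swap, Prod.snd_swap]
  rw [← neg_sub w.1 w.2, hodd]
  ring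

theorem abs_tentForm_le_right {k : V → ℝ} {d : ℕ} {c C : ℝ} (hd : Module.finrank ℝ V = d)
    (hV : HasGrowth (volume : Measure V) d c) (hk : IsCZ k d C) (hodd : ∀ u, k (-u) = -k u)
    (hint : Integrable k) (hkm : Measurable k) {σ θ : ℝ} (hσ : 0 < σ) (hθ : 0 < θ) (a b : V) :
    |tentForm d k σ θ a b| ≤ c * (C * (c * 2 ^ (d + 3))) / θ ^ d := by
  have hC := hk.nonneg
  have hc := hV.nonneg
  have hi := integrable_tentForm (d := d) hint hkm hσ hθ a b
  rw [tentForm]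
  rw [Measure.volume_eq_prod] at hi ⊢
  rw [integral_prod _ hi]
  have inner : ∀ w₁ : V, ∫ w₂, k (w₁ - w₂) * tent d σ (w₁ - a) * tent d θ (w₂ - b)
      = (∫ v, k v * tent d θ (w₁ - b - v)) * tent d σ (w₁ - a) := fun w₁ => by
    rw [← integral_mul_const, ← integral_sub_left_eq_self _ volume w₁]
    refine integral_congr_ae (Eventually.of_forall fun v => ?_)
    simp only
    rw [_root_.sub_sub_cancel, sub_right_comm]
    ring
  simp_rw [inner]
  have hi2 : Integrable fun w₁ => C * (c * 2 ^ (d + 3)) / θ ^ d * tent d σ (w₁ - a) :=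
    ((integrable_tent d hσ).comp_sub_right a).const_mul _
  rw [← Real.norm_eq_abs]
  refine (norm_integral_le_of_norm_le hi2 (Eventually.of_forall fun w₁ => ?_)).trans ?_
  · rw [norm_mul, Real.norm_of_nonneg (tent_nonneg d hσ _)]
    gcongr
    · exact tent_nonneg d hσ _
    · exact abs_integral_mul_tent_le hd hV hk hodd hint hθ _
  · rw [integral_const_mul, integral_tent_sub hd hσ, mul_comm, mul_div_assoc c]
    exact mul_le_mul_of_nonneg_right (tentMass_le hV) (by positivity)

theorem abs_tentForm_le {k : V → ℝ} {d : ℕ} {c C : ℝ} (hd : Module.finrank ℝ V = d)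
    (hV : HasGrowth (volume : Measure V) d c) (hk : IsCZ k d C) (hodd : ∀ u, k (-u) = -k u)
    (hint : Integrable k) (hkm : Measurable k) {σ θ : ℝ} (hσ : 0 < σ) (hθ : 0 < θ) (a b : V) :
    |tentForm d k σ θ a b| ≤ C * c ^ 2 * 2 ^ (2 * d + 3) / (σ + θ) ^ d := by
  have hC := hk.nonneg
  have hc := hV.nonneg
  have aux : ∀ s : ℝ, 0 < s → σ + θ ≤ 2 * s →
      c * (C * (c * 2 ^ (d + 3))) / s ^ d ≤ C * c ^ 2 * 2 ^ (2 * d + 3) / (σ + θ) ^ d := by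
    intro s hs h
    calc c * (C * (c * 2 ^ (d + 3))) / s ^ d
        = C * c ^ 2 * 2 ^ (2 * d + 3) / (2 * s) ^ d := by
          rw [mul_pow, two_mul d, add_assoc, pow_add 2 d (d + 3)]
          field_simp
      _ ≤ _ := by gcongr
  rcases le_total σ θ with h | h
  · exact (abs_tentForm_le_right hd hV hk hodd hint hkm hσ hθ a b).trans (aux θ hθ (by linarith))
  · have := abs_tentForm_le_right hd hV hk hodd hint hkm hθ hσ b a
    rw [tentForm_swap hodd, abs_neg] at this
    exact this.trans (aux σ hσ (by linarith))

theorem abs_sub_tentForm_le {k : V → ℝ} {d : ℕ} {C : ℝ} (hd : Module.finrank ℝ V = d)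
    (hk : IsCZ k d C) (hint : Integrable k) (hkm : Measurable k) {σ θ : ℝ} (hσ : 0 < σ)
    (hθ : 0 < θ) (a b : V) (hab : 2 * (σ + θ) ≤ ‖a - b‖) :
    |tentMass V d ^ 2 * k (a - b) - tentForm d k σ θ a b|
      ≤ tentMass V d ^ 2 * (C * (σ + θ) / ‖a - b‖ ^ (d + 1)) := by
  have hC := hk.nonneg
  have hab' : 0 < ‖a - b‖ := by linarith
  have hmass : ∀ A : ℝ, ∫ w : V × V, A * (tent d σ (w.1 - a) * tent d θ (w.2 - b))
      = tentMass V d ^ 2 * A := fun A => by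
    rw [integral_const_mul, Measure.volume_eq_prod,
      integral_prod_mul (fun v => tent d σ (v - a)) (fun v => tent d θ (v - b)),
      integral_tent_sub hd hσ, integral_tent_sub hd hθ]
    ring
  have hI : ∀ A : ℝ, Integrable fun w : V × V =>
      A * (tent d σ (w.1 - a) * tent d θ (w.2 - b)) := fun A =>
    (((integrable_tent d hσ).comp_sub_right a).mul_prod
      ((integrable_tent d hθ).comp_sub_right b)).const_mul A
  rw [← hmass, ← hmass, tentForm,
    ← integral_sub (hI _) (integrable_tentForm hint hkm hσ hθ a b)]
  rw [← Real.norm_eq_abs]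
  refine norm_integral_le_of_norm_le (hI _) (Eventually.of_forall fun w => ?_)
  rw [mul_assoc, ← sub_mul, norm_mul]
  have h1 := tent_nonneg d hσ (w.1 - a)
  have h2 := tent_nonneg d hθ (w.2 - b)
  rw [Real.norm_of_nonneg (mul_nonneg h1 h2)]
  rcases le_total σ ‖w.1 - a‖ with h | h
  · simp [tent_eq_zero d hσ h]
  rcases le_total θ ‖w.2 - b‖ with h' | h'
  · simp [tent_eq_zero d hθ h']
  gcongr
  refine hk.abs_sub_le hab' le_rfl ?_ (by linarith)
  calc ‖a - b - (w.1 - w.2)‖ = ‖(w.2 - b) - (w.1 - a)‖ := by congr 1; abel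
    _ ≤ ‖w.2 - b‖ + ‖w.1 - a‖ := norm_sub_le _ _
    _ ≤ σ + θ := by linarith

end Tent

/-- The kernel `K` restricted to the complement of the closed ball of radius `ε`. -/
def truncKernel {F : Type*} [Norm F] (K : F → ℝ) (ε : ℝ) (x : F) : ℝ :=
  {x : F | ε < ‖x‖}.indicator K x

section Compare

variable {V F : Type*} [NormedAddCommGroup V] [InnerProductSpace ℝ V]
  [NormedAddCommGroup F] [InnerProductSpace ℝ F]
  {J : V →ₗᵢ[ℝ] F} {p : F →L[ℝ] V} {e : F}

theorem IsSlicing.abs_sub_slice_le (h : IsSlicing J p e) {K : F → ℝ} {d : ℕ} {C : ℝ}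
    (hK : IsCZ K d C) {ε τ : ℝ} (hε : 0 < ε) (hτ : ε ≤ τ) {z : F} (hz : |inner ℝ e z| ≤ τ)
    (hp : 4 * τ ≤ ‖p z‖) :
    |K z - slice J e K ε (p z)| ≤ C * (2 * τ) / ‖p z‖ ^ (d + 1) := by
  have hpos : 0 < ‖p z‖ := by linarith
  have hle : ‖p z‖ ≤ ‖z‖ := by
    have := h.norm_le (p z) (inner ℝ e z)
    rwa [h.decomp] at this
  have key : ∀ a : ℝ, |a| ≤ ε → |K z - K (J (p z) + a • e)| ≤ C * (2 * τ) / ‖p z‖ ^ (d + 1) := by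
    intro a ha
    refine hK.abs_sub_le hpos hle ?_ (by linarith)
    nth_rewrite 1 [← h.decomp z]
    rw [add_sub_add_left_eq_sub, ← sub_smul, norm_smul, h.norm_e, mul_one, Real.norm_eq_abs]
    linarith [abs_sub (inner ℝ e z) a]
  have h1 := key ε (abs_of_pos hε).le
  have h2 := key (-ε) (by rw [abs_neg, abs_of_pos hε])
  rw [neg_smul, ← sub_eq_add_neg] at h2
  have e1 : K z - slice J e K ε (p z)
      = ((K z - K (J (p z) + ε • e)) + (K z - K (J (p z) - ε • e))) / 2 := by rw [slice]; ring
  rw [e1, abs_div, abs_two]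
  linarith [abs_add_le (K z - K (J (p z) + ε • e)) (K z - K (J (p z) - ε • e))]

variable [FiniteDimensional ℝ V] [MeasurableSpace V] [BorelSpace V]

/-- For points on opposite sides of a hyperplane, the truncated kernel is comparable with a
kernel on the hyperplane tested against bumps whose widths are the distances to it. -/
theorem IsSlicing.exists_abs_truncKernel_sub_tentForm_le (h : IsSlicing J p e) {d : ℕ}
    (hd : Module.finrank ℝ V = d) {c : ℝ} (hV : HasGrowth (volume : Measure V) d c)
    {K : F → ℝ} {C : ℝ} (hK : IsCZ K d C) (hodd : ∀ x, K (-x) = -K x)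
    (hcont : ContinuousOn K {0}ᶜ) :
    ∃ A, 0 ≤ A ∧ ∀ ε s t : ℝ, 0 < ε → 0 ≤ s → 0 ≤ t → ∀ x y : F, |inner ℝ e (x - y)| = s + t →
      |tentMass V d ^ 2 * truncKernel K ε (x - y)
        - tentForm d (slice J e (fun x => K x * cutoff x) ε) (s + ε) (t + ε) (p x) (p y)|
      ≤ A * ((s + ε + (t + ε)) / (s + ε + (t + ε) + dist x y) ^ (d + 1)) + c ^ 2 * C := by
  have hC := hK.nonneg
  have hc := hV.nonneg
  have hm0 : 0 ≤ tentMass V d := (tentMass_pos d).le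
  have hm : tentMass V d ^ 2 ≤ c ^ 2 := by gcongr; exact tentMass_le hV
  obtain ⟨C', hC'⟩ : ∃ C', C' = C * (1 + 2 ^ (d + 2)) := ⟨_, rfl⟩
  have hKc : IsCZ (fun x => K x * cutoff x) d C' := hC' ▸ hK.mul_cutoff
  have hC'0 := hKc.nonneg
  refine ⟨(c ^ 2 * (C * 3 ^ d) + C' * c ^ 2 * 2 ^ (2 * d + 3)) * 6 ^ (d + 1)
    + c ^ 2 * (3 * C') * 2 ^ (d + 1), by positivity, fun ε s t hε hs ht x y hxy => ?_⟩
  obtain ⟨k, hkdef⟩ : ∃ k, k = slice J e (fun x => K x * cutoff x) ε := ⟨_, rfl⟩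
  rw [← hkdef]
  have hk : IsCZ k d C' := hkdef ▸ h.isCZ_slice hKc ε
  have hkodd : ∀ u, k (-u) = -k u := hkdef ▸ slice_neg
    (fun x => by rw [hodd, cutoff, norm_neg, ← cutoff]; ring) ε
  have hkint : Integrable k := hkdef ▸ h.integrable_slice_cutoff hcont hε
  have hkm : Measurable k := hkdef ▸ (h.continuous_slice
    (hcont.mul continuous_cutoff.continuousOn) hε).measurable
  obtain ⟨τ, hτdef⟩ : ∃ τ, τ = s + ε + (t + ε) := ⟨_, rfl⟩
  have hτ : 0 < τ := by linarith
  have hxn : |inner ℝ e (x - y)| ≤ ‖x - y‖ := by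
    have := h.abs_le (p (x - y)) (inner ℝ e (x - y))
    rwa [h.decomp] at this
  have hpn : ‖p (x - y)‖ ≤ ‖x - y‖ := by
    have := h.norm_le (p (x - y)) (inner ℝ e (x - y))
    rwa [h.decomp] at this
  have hnp : ‖x - y‖ ≤ ‖p (x - y)‖ + |inner ℝ e (x - y)| := by
    nth_rewrite 1 [← h.decomp (x - y)]
    refine (norm_add_le _ _).trans ?_
    rw [J.norm_map, norm_smul, h.norm_e, mul_one, Real.norm_eq_abs]
  have hD : 0 < τ + ‖x - y‖ := by positivity
  rw [← hτdef, dist_eq_norm]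
  rcases lt_or_ge ‖p (x - y)‖ (4 * τ) with hnear | hfar
  · have h1 : |truncKernel K ε (x - y)| ≤ C * 3 ^ d / τ ^ d := by
      by_cases hx : ε < ‖x - y‖
      · rw [truncKernel, Set.indicator_of_mem (by exact hx)]
        refine (hK.abs_le (r := τ / 3) (by positivity) (by linarith)).trans_eq ?_
        rw [div_pow]
        field_simp
      · rw [truncKernel, Set.indicator_of_notMem (by exact hx), abs_zero]
        positivity
    have h2 := abs_tentForm_le hd hV hk hkodd hkint hkm (add_pos_of_nonneg_of_pos hs hε)
      (add_pos_of_nonneg_of_pos ht hε) (p x) (p y)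
    rw [← hτdef] at h2
    have h3 : 1 / τ ^ d ≤ 6 ^ (d + 1) * (τ / (τ + ‖x - y‖) ^ (d + 1)) := by
      calc 1 / τ ^ d = 6 ^ (d + 1) * (τ / (6 * τ) ^ (d + 1)) := by
            rw [mul_pow, pow_succ τ d]; field_simp
        _ ≤ _ := by gcongr; linarith
    calc _ ≤ |tentMass V d ^ 2 * truncKernel K ε (x - y)|
          + |tentForm d k (s + ε) (t + ε) (p x) (p y)| := abs_sub _ _
      _ ≤ c ^ 2 * (C * 3 ^ d / τ ^ d) + C' * c ^ 2 * 2 ^ (2 * d + 3) / τ ^ d := by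
          rw [abs_mul, abs_of_nonneg (by positivity)]
          gcongr
      _ = (c ^ 2 * (C * 3 ^ d) + C' * c ^ 2 * 2 ^ (2 * d + 3)) * (1 / τ ^ d) := by ring
      _ ≤ (c ^ 2 * (C * 3 ^ d) + C' * c ^ 2 * 2 ^ (2 * d + 3))
          * (6 ^ (d + 1) * (τ / (τ + ‖x - y‖) ^ (d + 1))) := by gcongr
      _ ≤ _ := by
          rw [← mul_assoc, add_mul _ (c ^ 2 * (3 * C') * 2 ^ (d + 1)), add_assoc]
          refine le_add_of_nonneg_right ?_
          positivity
  · have hu : 0 < ‖p (x - y)‖ := by linarith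
    have htr : truncKernel K ε (x - y) = K (x - y) :=
      Set.indicator_of_mem (by rw [Set.mem_ofPred_eq]; linarith) K
    have h1 := abs_sub_tentForm_le hd hk hkint hkm (add_pos_of_nonneg_of_pos hs hε)
      (add_pos_of_nonneg_of_pos ht hε) (p x) (p y) (by rw [← map_sub]; linarith)
    have h2 := h.abs_sub_slice_le hKc hε (τ := τ) (by linarith) (z := x - y) (by linarith) hfar
    have h3 := hK.abs_sub_mul_cutoff_le (x - y)
    rw [← hkdef] at h2
    rw [← map_sub, ← hτdef] at h1
    have h4 : 1 / ‖p (x - y)‖ ^ (d + 1) ≤ 2 ^ (d + 1) * (1 / (τ + ‖x - y‖) ^ (d + 1)) := by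
      calc 1 / ‖p (x - y)‖ ^ (d + 1) = 2 ^ (d + 1) * (1 / (2 * ‖p (x - y)‖) ^ (d + 1)) := by
            rw [mul_pow]; field_simp
        _ ≤ _ := by gcongr; linarith
    rw [htr]
    have e1 : tentMass V d ^ 2 * K (x - y) - tentForm d k (s + ε) (t + ε) (p x) (p y)
        = tentMass V d ^ 2 * (K (x - y) - K (x - y) * cutoff (x - y))
        + (tentMass V d ^ 2 * (K (x - y) * cutoff (x - y) - k (p (x - y)))
        + (tentMass V d ^ 2 * k (p (x - y)) - tentForm d k (s + ε) (t + ε) (p x) (p y))) := by ring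
    rw [e1]
    calc _ ≤ c ^ 2 * C + (c ^ 2 * (C' * (2 * τ) / ‖p (x - y)‖ ^ (d + 1))
          + c ^ 2 * (C' * τ / ‖p (x - y)‖ ^ (d + 1))) := by
          refine (abs_add_le _ _).trans (add_le_add ?_ ((abs_add_le _ _).trans
            (add_le_add ?_ (h1.trans (by gcongr)))))
          · rw [abs_mul, abs_of_nonneg (by positivity)]; gcongr
          · rw [abs_mul, abs_of_nonneg (by positivity)]; gcongr
      _ = c ^ 2 * (3 * C') * τ * (1 / ‖p (x - y)‖ ^ (d + 1)) + c ^ 2 * C := by ring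
      _ ≤ c ^ 2 * (3 * C') * τ * (2 ^ (d + 1) * (1 / (τ + ‖x - y‖) ^ (d + 1))) + c ^ 2 * C := by
          gcongr
      _ = c ^ 2 * (3 * C') * 2 ^ (d + 1) * (τ / (τ + ‖x - y‖) ^ (d + 1)) + c ^ 2 * C := by ring
      _ ≤ _ := by
          gcongr
          refine le_add_of_nonneg_left ?_
          positivity

end Compare

section TentAverage

variable {X V : Type*} [MeasurableSpace X] [NormedAddCommGroup V] [InnerProductSpace ℝ V]
  [FiniteDimensional ℝ V] [MeasurableSpace V] [BorelSpace V]

/-- The density obtained by spreading a measure `ν` over `V`, the point `x` being replaced by a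
bump of width `η x` at `p x`. -/
def tentAverage (d : ℕ) (η : X → ℝ) (p : X → V) (ν : Measure X) (w : V) : ℝ :=
  ∫ x, tent d (η x) (w - p x) ∂ν

variable {d : ℕ} {η : X → ℝ} {p : X → V} {ν : Measure X}

theorem measurable_tent_sub (hη : Measurable η) (hp : Measurable p) :
    Measurable fun q : X × V => tent d (η q.1) (q.2 - p q.1) := by
  unfold tent; fun_prop

theorem lintegral_tent_sub_le {c t : ℝ} (hd : Module.finrank ℝ V = d)
    (hV : HasGrowth (volume : Measure V) d c) (ht : 0 < t) (a : V) :
    ∫⁻ w : V, ENNReal.ofReal (tent d t (w - a)) ≤ ENNReal.ofReal c := by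
  rw [← ofReal_integral_eq_lintegral_ofReal ((integrable_tent d ht).comp_sub_right a)
    (Eventually.of_forall fun w => tent_nonneg d ht _), integral_tent_sub hd ht]
  exact ENNReal.ofReal_le_ofReal (tentMass_le hV)

theorem integrable_tent_sub [IsFiniteMeasure ν] (hη : Measurable η)
    (hp : Measurable p) {ε : ℝ} (hε : 0 < ε) (hηε : ∀ x, ε ≤ η x) (w : V) :
    Integrable (fun x => tent d (η x) (w - p x)) ν := by
  refine Integrable.of_bound (((measurable_tent_sub hη hp).comp
    measurable_prodMk_right).aestronglyMeasurable) (1 / ε ^ d) (Eventually.of_forall fun x => ?_)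
  have hpos := hε.trans_le (hηε x)
  rw [Real.norm_of_nonneg (tent_nonneg d hpos _)]
  refine (tent_le d hpos _).trans ?_
  gcongr
  exact hηε x

theorem enorm_tentAverage [IsFiniteMeasure ν] (hη : Measurable η) (hp : Measurable p) {ε : ℝ}
    (hε : 0 < ε) (hηε : ∀ x, ε ≤ η x) (w : V) :
    ‖tentAverage d η p ν w‖ₑ = ∫⁻ x, ENNReal.ofReal (tent d (η x) (w - p x)) ∂ν := by
  have hnn : ∀ x, 0 ≤ tent d (η x) (w - p x) := fun x => tent_nonneg d (hε.trans_le (hηε x)) _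
  rw [tentAverage, ← ofReal_integral_eq_lintegral_ofReal (integrable_tent_sub hη hp hε hηε w)
    (Eventually.of_forall hnn), Real.enorm_of_nonneg (integral_nonneg hnn)]

theorem measurable_tentAverage [SFinite ν] (hη : Measurable η) (hp : Measurable p) :
    Measurable (tentAverage d η p ν) := by
  have h : Measurable fun q : V × X => tent d (η q.2) (q.1 - p q.2) :=
    (measurable_tent_sub hη hp).comp measurable_swap
  exact h.stronglyMeasurable.integral_prod_right'.measurable

end TentAverage

/-- Schur-type bound for the `L²` norm of an average. -/
theorem lintegral_sq_lintegral_le {X V : Type*} [MeasurableSpace X] [MeasurableSpace V]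
    {ν : Measure X} [SFinite ν] {m : Measure V} [SFinite m] {T : X → V → ℝ≥0∞}
    (hT : Measurable fun q : X × V => T q.1 q.2) {G : X → X → ℝ≥0∞}
    (hG : Measurable fun q : X × X => G q.1 q.2) {B : ℝ≥0∞}
    (hTG : ∀ x y, ∫⁻ w, T x w * T y w ∂m ≤ G x y + G y x) (hB : ∀ x, ∫⁻ y, G x y ∂ν ≤ B) :
    ∫⁻ w, (∫⁻ x, T x w ∂ν) ^ 2 ∂m ≤ 2 * (B * ν univ) := by
  have hTw : ∀ w, Measurable fun x => T x w := fun w => hT.comp measurable_prodMk_right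
  calc ∫⁻ w, (∫⁻ x, T x w ∂ν) ^ 2 ∂m
      = ∫⁻ w, ∫⁻ x, ∫⁻ y, T x w * T y w ∂ν ∂ν ∂m := by
        refine lintegral_congr fun w => ?_
        rw [sq, ← lintegral_mul_const _ (hTw w)]
        refine lintegral_congr fun x => ?_
        rw [← lintegral_const_mul _ (hTw w)]
    _ = ∫⁻ x, (∫⁻ w, ∫⁻ y, T x w * T y w ∂ν ∂m) ∂ν := by
        refine lintegral_lintegral_swap (Measurable.aemeasurable ?_)
        refine Measurable.lintegral_prod_right'
          (f := fun q : (V × X) × X => T q.1.2 q.1.1 * T q.2 q.1.1) ?_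
        exact (hT.comp (measurable_swap.comp measurable_fst)).mul
          (hT.comp (measurable_snd.prodMk (measurable_fst.comp measurable_fst)))
    _ = ∫⁻ x, ∫⁻ y, (∫⁻ w, T x w * T y w ∂m) ∂ν ∂ν := by
        refine lintegral_congr fun x => lintegral_lintegral_swap (Measurable.aemeasurable ?_)
        exact (hT.comp (measurable_const.prodMk measurable_fst)).mul (hT.comp measurable_swap)
    _ ≤ ∫⁻ x, ∫⁻ y, (G x y + G y x) ∂ν ∂ν :=
        lintegral_mono fun x => lintegral_mono fun y => hTG x y
    _ = ∫⁻ x, ∫⁻ y, G x y ∂ν ∂ν + ∫⁻ x, ∫⁻ y, G y x ∂ν ∂ν := by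
        rw [← lintegral_add_left hG.lintegral_prod_right']
        exact lintegral_congr fun x => lintegral_add_left (hG.comp measurable_prodMk_left) _
    _ = 2 * ∫⁻ x, ∫⁻ y, G x y ∂ν ∂ν := by
        rw [two_mul]
        congr 1
        exact lintegral_lintegral_swap (hG.comp measurable_swap).aemeasurable
    _ ≤ 2 * (B * ν univ) := by
        gcongr
        exact (lintegral_mono hB).trans_eq (lintegral_const _)

section TentAverageBound

variable {X V : Type*} [PseudoMetricSpace X] [NormedAddCommGroup V] [InnerProductSpace ℝ V]
  [FiniteDimensional ℝ V] [MeasurableSpace V] [BorelSpace V]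
  {d : ℕ} {η : X → ℝ} {p : X → V}

theorem lintegral_tent_mul_tent_le {c : ℝ} (hd : Module.finrank ℝ V = d)
    (hV : HasGrowth (volume : Measure V) d c) (hpos : ∀ x, 0 < η x)
    (hdist : ∀ x y, dist x y ≤ ‖p x - p y‖ + η x + η y) {x y : X} (hxy : η y ≤ η x) :
    ∫⁻ w, ENNReal.ofReal (tent d (η x) (w - p x)) * ENNReal.ofReal (tent d (η y) (w - p y))
      ≤ (closedBall x (4 * η x)).indicator (fun _ => ENNReal.ofReal (c / η x ^ d)) y := by
  have hc := hV.nonneg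
  by_cases h : y ∈ closedBall x (4 * η x)
  · rw [Set.indicator_of_mem h]
    calc _ ≤ ∫⁻ w, ENNReal.ofReal (1 / η x ^ d) * ENNReal.ofReal (tent d (η y) (w - p y)) := by
          gcongr
          exact tent_le d (hpos x) _
      _ = ENNReal.ofReal (1 / η x ^ d) * ∫⁻ w, ENNReal.ofReal (tent d (η y) (w - p y)) :=
          lintegral_const_mul' _ _ ENNReal.ofReal_ne_top
      _ ≤ ENNReal.ofReal (1 / η x ^ d) * ENNReal.ofReal c := by
          gcongr
          exact lintegral_tent_sub_le hd hV (hpos y) _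
      _ = _ := by
          rw [← ENNReal.ofReal_mul (by have := hpos x; positivity)]
          congr 1
          ring
  · rw [Set.indicator_of_notMem h]
    rw [mem_closedBall, dist_comm, not_le] at h
    refine le_of_eq (lintegral_eq_zero_of_ae_eq_zero (Eventually.of_forall fun w => ?_))
    simp only [Pi.zero_apply, mul_eq_zero]
    rcases le_total (η x) ‖w - p x‖ with h1 | h1
    · exact Or.inl (by rw [tent_eq_zero d (hpos x) h1, ENNReal.ofReal_zero])
    · refine Or.inr ?_
      have h2 := hdist x y
      have h3 := norm_sub_le (w - p y) (w - p x)
      rw [_root_.sub_sub_sub_cancel_left] at h3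
      rw [tent_eq_zero d (hpos y) (by linarith), ENNReal.ofReal_zero]

variable [SecondCountableTopology X] [MeasurableSpace X] [OpensMeasurableSpace X]
  {ν : Measure X}

theorem lintegral_enorm_tentAverage_sq_le [IsFiniteMeasure ν] {c C : ℝ}
    (hd : Module.finrank ℝ V = d)
    (hV : HasGrowth (volume : Measure V) d c) (hν : HasGrowth ν d C)
    (hη : Measurable η) (hp : Measurable p) {ε : ℝ} (hε : 0 < ε) (hηε : ∀ x, ε ≤ η x)
    (hdist : ∀ x y, dist x y ≤ ‖p x - p y‖ + η x + η y) :
    ∫⁻ w, ‖tentAverage d η p ν w‖ₑ ^ 2 ≤ ENNReal.ofReal (2 * (c * C * 4 ^ d)) * ν univ := by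
  have hc := hV.nonneg
  have hC := hν.nonneg
  have hpos : ∀ x, 0 < η x := fun x => hε.trans_le (hηε x)
  have hGm : Measurable fun q : X × X =>
      (closedBall q.1 (4 * η q.1)).indicator (fun _ => ENNReal.ofReal (c / η q.1 ^ d)) q.2 := by
    have : (fun q : X × X =>
        (closedBall q.1 (4 * η q.1)).indicator (fun _ => ENNReal.ofReal (c / η q.1 ^ d)) q.2)
        = {q : X × X | dist q.2 q.1 ≤ 4 * η q.1}.indicator
          fun q => ENNReal.ofReal (c / η q.1 ^ d) := by
      ext q
      simp only [Set.indicator_apply]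
      rfl
    rw [this]
    refine Measurable.indicator (by fun_prop) (measurableSet_le (by fun_prop) (by fun_prop))
  have hGx : ∀ x, ∫⁻ y, (closedBall x (4 * η x)).indicator
      (fun _ => ENNReal.ofReal (c / η x ^ d)) y ∂ν ≤ ENNReal.ofReal (c * C * 4 ^ d) := fun x => by
    have h4 : 0 < 4 * η x := by linarith [hpos x]
    have hx := hpos x
    rw [lintegral_indicator_const isClosed_closedBall.measurableSet]
    calc ENNReal.ofReal (c / η x ^ d) * ν (closedBall x (4 * η x))
        ≤ ENNReal.ofReal (c / η x ^ d) * ENNReal.ofReal (C * (4 * η x) ^ d) := by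
          gcongr
          exact hν.le x _ h4
      _ = _ := by
          rw [← ENNReal.ofReal_mul (by positivity)]
          congr 1
          rw [mul_pow]
          field_simp
  refine (lintegral_congr fun w => by rw [enorm_tentAverage hη hp hε hηε]).trans_le
    ((lintegral_sq_lintegral_le (measurable_tent_sub hη hp).ennreal_ofReal hGm (fun x y => ?_)
      hGx).trans_eq ?_)
  · rcases le_total (η y) (η x) with h | h
    · exact (lintegral_tent_mul_tent_le hd hV hpos hdist h).trans le_self_add
    · simp_rw [mul_comm (ENNReal.ofReal (tent d (η x) _))]
      exact (lintegral_tent_mul_tent_le hd hV hpos hdist h).trans le_add_self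
  · rw [ENNReal.ofReal_mul two_pos.le, ENNReal.ofReal_ofNat]
    ring

end TentAverageBound

section TentBilinear

variable {X V : Type*} [PseudoMetricSpace X] [SecondCountableTopology X] [MeasurableSpace X]
  [OpensMeasurableSpace X] [NormedAddCommGroup V] [InnerProductSpace ℝ V]
  [FiniteDimensional ℝ V] [MeasurableSpace V] [BorelSpace V]
  {d : ℕ} {η : X → ℝ} {p : X → V}

theorem eLpNorm_tentAverage_le {ν : Measure X} [IsFiniteMeasure ν] {c C : ℝ}
    (hd : Module.finrank ℝ V = d)
    (hV : HasGrowth (volume : Measure V) d c) (hν : HasGrowth ν d C)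
    (hη : Measurable η) (hp : Measurable p) {ε : ℝ} (hε : 0 < ε) (hηε : ∀ x, ε ≤ η x)
    (hdist : ∀ x y, dist x y ≤ ‖p x - p y‖ + η x + η y) :
    eLpNorm (fun w => (tentAverage d η p ν w : ℂ)) 2 volume
      ≤ (ENNReal.ofReal (2 * (c * C * 4 ^ d)) * ν univ) ^ (1 / 2 : ℝ) := by
  rw [eLpNorm_eq_lintegral_rpow_enorm_toReal two_ne_zero ENNReal.ofNat_ne_top]
  simp only [ENNReal.toReal_ofNat, ENNReal.rpow_ofNat]
  gcongr
  refine le_trans (lintegral_mono fun w => ?_)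
    (lintegral_enorm_tentAverage_sq_le hd hV hν hη hp hε hηε hdist)
  gcongr
  exact (enorm_eq_iff_norm_eq.2 (Complex.norm_real _)).le

theorem memLp_tentAverage {ν : Measure X} [IsFiniteMeasure ν] {c C : ℝ}
    (hd : Module.finrank ℝ V = d)
    (hV : HasGrowth (volume : Measure V) d c) (hν : HasGrowth ν d C)
    (hη : Measurable η) (hp : Measurable p) {ε : ℝ} (hε : 0 < ε) (hηε : ∀ x, ε ≤ η x)
    (hdist : ∀ x y, dist x y ≤ ‖p x - p y‖ + η x + η y) :
    MemLp (fun w => (tentAverage d η p ν w : ℂ)) 2 volume := by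
  refine ⟨(Complex.measurable_ofReal.comp (measurable_tentAverage hη hp)).aestronglyMeasurable,
    (eLpNorm_tentAverage_le hd hV hν hη hp hε hηε hdist).trans_lt ?_⟩
  exact ENNReal.rpow_lt_top_of_nonneg (by norm_num)
    (ENNReal.mul_ne_top ENNReal.ofReal_ne_top (measure_ne_top _ _))

theorem integrable_tentKernel {ν ρ : Measure X} [IsFiniteMeasure ν] [IsFiniteMeasure ρ]
    {c C : ℝ} (hd : Module.finrank ℝ V = d) (hV : HasGrowth (volume : Measure V) d c)
    (hν : HasGrowth ν d C) (hρ : HasGrowth ρ d C) (hη : Measurable η) (hp : Measurable p)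
    {ε : ℝ} (hε : 0 < ε) (hηε : ∀ x, ε ≤ η x)
    (hdist : ∀ x y, dist x y ≤ ‖p x - p y‖ + η x + η y)
    {k : V → ℝ} (hk : Integrable k) (hkm : Measurable k) :
    Integrable (fun z : (X × X) × (V × V) => k (z.2.1 - z.2.2) *
      (tent d (η z.1.1) (z.2.1 - p z.1.1) * tent d (η z.1.2) (z.2.2 - p z.1.2)))
      ((ν.prod ρ).prod volume) := by
  have hT := measurable_tent_sub (V := V) (d := d) hη hp
  have hm : Measurable fun z : (X × X) × (V × V) => k (z.2.1 - z.2.2) *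
      (tent d (η z.1.1) (z.2.1 - p z.1.1) * tent d (η z.1.2) (z.2.2 - p z.1.2)) :=
    Measurable.mul (by fun_prop)
      ((hT.comp ((measurable_fst.comp measurable_fst).prodMk
        (measurable_fst.comp measurable_snd))).mul
      (hT.comp ((measurable_snd.comp measurable_fst).prodMk
        (measurable_snd.comp measurable_snd))))
  have hpos : ∀ x, 0 < η x := fun x => hε.trans_le (hηε x)
  rw [integrable_prod_iff' hm.aestronglyMeasurable]
  refine ⟨Eventually.of_forall fun w => ?_, ?_⟩
  · exact ((integrable_tent_sub (d := d) (ν := ν) hη hp hε hηε w.1).mul_prod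
      (integrable_tent_sub (d := d) (ν := ρ) hη hp hε hηε w.2)).const_mul (k (w.1 - w.2))
  have h1 := integrable_bilinear (k := fun v => ((|k v| : ℝ) : ℂ)) hk.abs.ofReal (by fun_prop)
    (Complex.measurable_ofReal.comp (measurable_tentAverage (ν := ν) hη hp))
    (Complex.measurable_ofReal.comp (measurable_tentAverage (ν := ρ) hη hp))
    (memLp_tentAverage hd hV hν hη hp hε hηε hdist)
    (memLp_tentAverage hd hV hρ hη hp hε hηε hdist)
  refine (h1.re).congr (Eventually.of_forall fun w => ?_)
  have h2 : ∀ q : X × X, ‖k (w.1 - w.2) *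
      (tent d (η q.1) (w.1 - p q.1) * tent d (η q.2) (w.2 - p q.2))‖
      = |k (w.1 - w.2)| * (tent d (η q.1) (w.1 - p q.1) * tent d (η q.2) (w.2 - p q.2)) :=
    fun q => by
      rw [norm_mul, Real.norm_eq_abs, Real.norm_of_nonneg
        (mul_nonneg (tent_nonneg d (hpos _) _) (tent_nonneg d (hpos _) _))]
  simp only [h2]
  rw [integral_const_mul, integral_prod_mul (fun x => tent d (η x) (w.1 - p x))
    (fun x => tent d (η x) (w.2 - p x))]
  simp [tentAverage, ← Complex.ofReal_mul, mul_assoc]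

open FourierTransform in
/-- Averages of `tentForm` are bounded through the `L²` norms of the averaged bumps. -/
theorem enorm_integral_tentForm_le {ν ρ : Measure X} [IsFiniteMeasure ν] [IsFiniteMeasure ρ]
    {c C : ℝ} (hd : Module.finrank ℝ V = d) (hV : HasGrowth (volume : Measure V) d c)
    (hν : HasGrowth ν d C) (hρ : HasGrowth ρ d C) (hη : Measurable η) (hp : Measurable p)
    {ε : ℝ} (hε : 0 < ε) (hηε : ∀ x, ε ≤ η x)
    (hdist : ∀ x y, dist x y ≤ ‖p x - p y‖ + η x + η y)
    {k : V → ℝ} (hk : Integrable k) (hkm : Measurable k) {M : ℝ}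
    (hM : ∀ ξ, ‖𝓕 (fun v => (k v : ℂ)) ξ‖ ≤ M) :
    Integrable (fun q : X × X => tentForm d k (η q.1) (η q.2) (p q.1) (p q.2)) (ν.prod ρ) ∧
    ‖∫ q : X × X, tentForm d k (η q.1) (η q.2) (p q.1) (p q.2) ∂(ν.prod ρ)‖ₑ
      ≤ ENNReal.ofReal M * ENNReal.ofReal (2 * (c * C * 4 ^ d))
        * (ν univ * ρ univ) ^ (1 / 2 : ℝ) := by
  have hint := integrable_tentKernel hd hV hν hρ hη hp hε hηε hdist hk hkm
  have hform : ∀ q : X × X, tentForm d k (η q.1) (η q.2) (p q.1) (p q.2)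
      = ∫ w : V × V, k (w.1 - w.2) *
        (tent d (η q.1) (w.1 - p q.1) * tent d (η q.2) (w.2 - p q.2)) := fun q => by
    simp only [tentForm, mul_assoc]
  have hi := hint.integral_prod_left
  refine ⟨hi.congr (Eventually.of_forall fun q => (hform q).symm), ?_⟩
  have e1 : ∫ q : X × X, tentForm d k (η q.1) (η q.2) (p q.1) (p q.2) ∂(ν.prod ρ)
      = ∫ w : V × V, k (w.1 - w.2) * (tentAverage d η p ν w.1 * tentAverage d η p ρ w.2) := by
    simp_rw [hform]
    rw [integral_integral_swap (f := fun (q : X × X) (w : V × V) => k (w.1 - w.2) *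
        (tent d (η q.1) (w.1 - p q.1) * tent d (η q.2) (w.2 - p q.2))) hint]
    refine integral_congr_ae (Eventually.of_forall fun w => ?_)
    simp only
    rw [integral_const_mul, integral_prod_mul (fun x => tent d (η x) (w.1 - p x))
      (fun x => tent d (η x) (w.2 - p x))]
    rfl
  have e2 : ((∫ w : V × V, k (w.1 - w.2) *
        (tentAverage d η p ν w.1 * tentAverage d η p ρ w.2) : ℝ) : ℂ)
      = ∫ w : V × V, (k (w.1 - w.2) : ℂ) * (tentAverage d η p ν w.1 : ℂ)
        * (tentAverage d η p ρ w.2 : ℂ) := by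
    rw [← integral_complex_ofReal]
    simp [mul_assoc]
  have e3 := enorm_bilinear_le (k := fun v => (k v : ℂ)) hk.ofReal (by fun_prop) hM
    (Complex.measurable_ofReal.comp (measurable_tentAverage hη hp))
    (Complex.measurable_ofReal.comp (measurable_tentAverage hη hp))
    (memLp_tentAverage hd hV hν hη hp hε hηε hdist)
    (memLp_tentAverage hd hV hρ hη hp hε hηε hdist)
  rw [e1, ← enorm_eq_iff_norm_eq.2 (Complex.norm_real _), e2]
  refine e3.trans ?_
  rw [mul_assoc]
  refine mul_le_mul' le_rfl ?_
  refine (mul_le_mul' (eLpNorm_tentAverage_le hd hV hν hη hp hε hηε hdist)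
    (eLpNorm_tentAverage_le hd hV hρ hη hp hε hηε hdist)).trans_eq ?_
  rw [← ENNReal.mul_rpow_of_nonneg _ _ (by norm_num), mul_mul_mul_comm, ← sq,
    ENNReal.mul_rpow_of_nonneg _ _ (by norm_num), ← ENNReal.rpow_ofNat, ← ENNReal.rpow_mul]
  norm_num

end TentBilinear

section TruncKernel

variable {F : Type*} [NormedAddCommGroup F]

theorem measurable_truncKernel [MeasurableSpace F] [BorelSpace F] {K : F → ℝ}
    (hK : ContinuousOn K {0}ᶜ) {ε : ℝ} (hε : 0 < ε) :
    Measurable (truncKernel K ε) := by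
  classical
  have hs : {x : F | ε < ‖x‖} ⊆ {0}ᶜ := fun x hx h0 => by
    rw [mem_singleton_iff.1 h0, Set.mem_ofPred_eq, norm_zero] at hx
    exact hx.not_gt hε
  have := (hK.mono hs).measurable_piecewise (g := fun _ => 0) continuousOn_const
    (measurableSet_lt measurable_const measurable_norm)
  convert this using 1
  ext x
  simp [truncKernel, Set.piecewise, Set.indicator_apply]

theorem abs_truncKernel_le {K : F → ℝ} {d : ℕ} {C : ℝ} (hK : IsCZ K d C) {ε : ℝ} (hε : 0 < ε)
    (x : F) : |truncKernel K ε x| ≤ C / ε ^ d := by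
  have hC := hK.nonneg
  by_cases hx : ε < ‖x‖
  · rw [truncKernel, Set.indicator_of_mem (by exact hx)]
    exact hK.abs_le hε hx.le
  · rw [truncKernel, Set.indicator_of_notMem (by exact hx), abs_zero]
    positivity

theorem truncKernel_neg {K : F → ℝ} (hodd : ∀ x, K (-x) = -K x) (ε : ℝ) (x : F) :
    truncKernel K ε (-x) = -truncKernel K ε x := by
  by_cases hx : ε < ‖x‖
  · rw [truncKernel, truncKernel, Set.indicator_of_mem (by simpa using hx),
      Set.indicator_of_mem (by exact hx), hodd]
  · rw [truncKernel, truncKernel, Set.indicator_of_notMem (by simpa using hx),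
      Set.indicator_of_notMem (by exact hx), neg_zero]

end TruncKernel

theorem poisson_add_le {a b r : ℝ} (n : ℕ) (ha : 0 < a) (hb : 0 ≤ b) (hr : 0 ≤ r) :
    (a + b) / (a + b + r) ^ n ≤ a / (a + r) ^ n + b / (b + r) ^ n := by
  rcases hb.eq_or_lt with rfl | hb
  · simp
  rw [add_div]
  gcongr <;> linarith

theorem HasGrowth.lintegral_poisson_prod_le {F : Type*} [PseudoMetricSpace F]
    [SecondCountableTopology F] [MeasurableSpace F] [OpensMeasurableSpace F] {ν ρ : Measure F}
    [SFinite ρ] {d : ℕ} {C : ℝ}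
    (hρ : HasGrowth ρ d C) {τ : F → ℝ} (hτ : Measurable τ) (hpos : ∀ x, 0 < τ x) :
    ∫⁻ q : F × F, ENNReal.ofReal (τ q.1 / (τ q.1 + dist q.1 q.2) ^ (d + 1)) ∂(ν.prod ρ)
      ≤ ENNReal.ofReal (C * 2 ^ (d + 2)) * ν univ := by
  rw [lintegral_prod _ (Measurable.aemeasurable (by fun_prop))]
  exact (lintegral_mono fun x => hρ.lintegral_poisson_le x (hpos x)).trans_eq (lintegral_const _)

section Core

variable {V F : Type*} [NormedAddCommGroup V] [InnerProductSpace ℝ V]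
  [FiniteDimensional ℝ V] [MeasurableSpace V] [BorelSpace V]
  [NormedAddCommGroup F] [InnerProductSpace ℝ F] [SecondCountableTopology F]
  [MeasurableSpace F] [BorelSpace F]
  {J : V →ₗᵢ[ℝ] F} {p : F →L[ℝ] V} {e : F}

/-- The truncated double integral over two sets separated by a hyperplane is bounded uniformly in
the truncation. -/
theorem IsSlicing.exists_enorm_integral_truncKernel_le (h : IsSlicing J p e) {d : ℕ}
    (hd : Module.finrank ℝ V = d) {c : ℝ} (hV : HasGrowth (volume : Measure V) d c)
    {K : F → ℝ} {C : ℝ} (hK : IsCZ K d C) (hodd : ∀ x, K (-x) = -K x)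
    (hcont : ContinuousOn K {0}ᶜ) {Cμ : ℝ} :
    ∃ B : ℝ≥0∞, B ≠ ⊤ ∧ ∀ (ν ρ : Measure F) [IsFiniteMeasure ν] [IsFiniteMeasure ρ]
      (_ : HasGrowth ν d Cμ) (_ : HasGrowth ρ d Cμ) (s : F → ℝ) (_ : Measurable s)
      (_ : ∀ x, 0 ≤ s x) (_ : ∀ x y, |inner ℝ e (x - y)| ≤ s x + s y)
      (_ : ∀ᵐ q : F × F ∂(ν.prod ρ), |inner ℝ e (q.1 - q.2)| = s q.1 + s q.2) (ε : ℝ) (_ : 0 < ε),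
      ‖∫ q : F × F, truncKernel K ε (q.1 - q.2) ∂(ν.prod ρ)‖ₑ
        ≤ B * ((ν univ * ρ univ) ^ (1 / 2 : ℝ) + ν univ
          + ∫⁻ q : F × F, ENNReal.ofReal (s q.2 / (s q.2 + dist q.1 q.2) ^ (d + 1)) ∂(ν.prod ρ)
          + ν univ * ρ univ) := by
  obtain ⟨A, hA, hmain⟩ := h.exists_abs_truncKernel_sub_tentForm_le hd hV hK hodd hcont
  have hC := hK.nonneg
  obtain ⟨C', hC'⟩ : ∃ C', C' = C * (1 + 2 ^ (d + 2)) := ⟨_, rfl⟩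
  have hKc : IsCZ (fun x => K x * cutoff x) d C' := hC' ▸ hK.mul_cutoff
  have hodd' : ∀ x, K (-x) * cutoff (-x) = -(K x * cutoff x) := fun x => by
    rw [hodd, cutoff, cutoff, norm_neg]; ring
  set m := tentMass V d with hm
  have hm0 : 0 < m ^ 2 := by have := tentMass_pos (V := V) d; positivity
  set M := C' * (c * 6 ^ (d + 4)) with hM
  set B := ENNReal.ofReal M * ENNReal.ofReal (2 * (c * Cμ * 4 ^ d))
    + ENNReal.ofReal A * ENNReal.ofReal (Cμ * 2 ^ (d + 2)) + ENNReal.ofReal A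
    + ENNReal.ofReal (c ^ 2 * C) with hB
  refine ⟨B / ENNReal.ofReal (m ^ 2), ENNReal.div_ne_top (by finiteness)
    (by simpa using hm0.ne'), ?_⟩
  intro ν ρ _ _ hν hρ s hs hs0 hsle hseq ε hε
  have hη : Measurable fun x => s x + ε := by fun_prop
  have hdist : ∀ x y, dist x y ≤ ‖p x - p y‖ + (s x + ε) + (s y + ε) := fun x y => by
    have h1 : ‖x - y‖ ≤ ‖p (x - y)‖ + |inner ℝ e (x - y)| := by
      nth_rewrite 1 [← h.decomp (x - y)]
      refine (norm_add_le _ _).trans_eq ?_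
      rw [J.norm_map, norm_smul, h.norm_e, mul_one, Real.norm_eq_abs]
    rw [dist_eq_norm]
    rw [map_sub] at h1
    linarith [hsle x y]
  set k := slice J e (fun x => K x * cutoff x) ε with hk
  have hki : Integrable k := h.integrable_slice_cutoff hcont hε
  have hkm : Measurable k :=
    (h.continuous_slice (hcont.mul continuous_cutoff.continuousOn) hε).measurable
  obtain ⟨hTi, hTle⟩ := enorm_integral_tentForm_le hd hV hν hρ hη p.continuous.measurable hε
    (fun x => by linarith [hs0 x]) hdist hki hkm
    (norm_fourier_le_of_isCZ_of_odd hV (h.isCZ_slice hKc ε) (slice_neg hodd' ε) hki)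
  have hKi : Integrable (fun q : F × F => truncKernel K ε (q.1 - q.2)) (ν.prod ρ) :=
    Integrable.of_bound ((measurable_truncKernel hcont hε).comp
      measurable_sub).aestronglyMeasurable (C / ε ^ d)
      (Eventually.of_forall fun q => abs_truncKernel_le hK hε _)
  set P : F × F → ℝ := fun q => (s q.1 + 2 * ε) / (s q.1 + 2 * ε + dist q.1 q.2) ^ (d + 1) with hP
  set Q : F × F → ℝ := fun q => s q.2 / (s q.2 + dist q.1 q.2) ^ (d + 1) with hQ
  have herr : ‖∫ q : F × F, (m ^ 2 * truncKernel K ε (q.1 - q.2) -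
      tentForm d k (s q.1 + ε) (s q.2 + ε) (p q.1) (p q.2)) ∂(ν.prod ρ)‖ₑ
      ≤ ENNReal.ofReal A * (ENNReal.ofReal (Cμ * 2 ^ (d + 2)) * ν univ)
        + ENNReal.ofReal A * ∫⁻ q : F × F, ENNReal.ofReal (Q q) ∂(ν.prod ρ)
        + ENNReal.ofReal (c ^ 2 * C) * (ν univ * ρ univ) := by
    refine (enorm_integral_le_lintegral_enorm _).trans ?_
    calc _ ≤ ∫⁻ q : F × F, (ENNReal.ofReal A * ENNReal.ofReal (P q)
          + ENNReal.ofReal A * ENNReal.ofReal (Q q) + ENNReal.ofReal (c ^ 2 * C)) ∂(ν.prod ρ) := by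
          refine lintegral_mono_ae (hseq.mono fun q hq => ?_)
          have h1 := hmain ε (s q.1) (s q.2) hε (hs0 _) (hs0 _) q.1 q.2 hq
          have h2 := poisson_add_le (d + 1) (by linarith [hs0 q.1] : 0 < s q.1 + 2 * ε) (hs0 q.2)
            (dist_nonneg (x := q.1) (y := q.2))
          have e1 : s q.1 + ε + (s q.2 + ε) = s q.1 + 2 * ε + s q.2 := by ring
          rw [e1] at h1
          have h3 := h1.trans (add_le_add_left (mul_le_mul_of_nonneg_left h2 hA) _)
          have hP0 : 0 ≤ P q := by have := hs0 q.1; positivity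
          have hQ0 : 0 ≤ Q q := by have := hs0 q.2; positivity
          rw [← ENNReal.ofReal_mul hA, ← ENNReal.ofReal_mul hA,
            ← ENNReal.ofReal_add (by positivity) (by positivity),
            ← ENNReal.ofReal_add (by positivity) (by positivity), ← mul_add,
            Real.enorm_eq_ofReal_abs]
          exact ENNReal.ofReal_le_ofReal h3
      _ = ENNReal.ofReal A * ∫⁻ q, ENNReal.ofReal (P q) ∂(ν.prod ρ)
          + ENNReal.ofReal A * ∫⁻ q, ENNReal.ofReal (Q q) ∂(ν.prod ρ)
          + ENNReal.ofReal (c ^ 2 * C) * (ν univ * ρ univ) := by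
          have hPm : Measurable fun q => ENNReal.ofReal (P q) := by fun_prop
          have hQm : Measurable fun q => ENNReal.ofReal (Q q) := by fun_prop
          rw [lintegral_add_left (by fun_prop), lintegral_add_left (by fun_prop),
            lintegral_const_mul _ hPm, lintegral_const_mul _ hQm, lintegral_const,
            ← univ_prod_univ, Measure.prod_prod]
      _ ≤ _ := by
          gcongr
          exact hρ.lintegral_poisson_prod_le (τ := fun x => s x + 2 * ε) (by fun_prop)
            fun x => by linarith [hs0 x]
  rw [integral_sub (hKi.const_mul _) hTi, integral_const_mul] at herr
  set I := ∫ q : F × F, truncKernel K ε (q.1 - q.2) ∂(ν.prod ρ) with hI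
  set T := ∫ q : F × F, tentForm d k (s q.1 + ε) (s q.2 + ε) (p q.1) (p q.2) ∂(ν.prod ρ) with hT
  have h4 : ‖I‖ₑ * ENNReal.ofReal (m ^ 2) ≤ ‖m ^ 2 * I - T‖ₑ + ‖T‖ₑ := by
    have : ‖I‖ₑ * ENNReal.ofReal (m ^ 2) = ‖(m ^ 2 * I - T) + T‖ₑ := by
      rw [sub_add_cancel, enorm_mul, Real.enorm_of_nonneg hm0.le, mul_comm]
    rw [this]
    exact enorm_add_le _ _
  rw [ENNReal.div_eq_inv_mul, mul_assoc, ← ENNReal.div_eq_inv_mul,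
    ENNReal.le_div_iff_mul_le (Or.inl (by simpa using hm0.ne')) (Or.inl ENNReal.ofReal_ne_top)]
  refine h4.trans ((add_le_add herr hTle).trans ?_)
  set S := (ν univ * ρ univ) ^ (1 / 2 : ℝ)
  set R := ∫⁻ q : F × F, ENNReal.ofReal (Q q) ∂(ν.prod ρ)
  set b1 := ENNReal.ofReal M * ENNReal.ofReal (2 * (c * Cμ * 4 ^ d))
  set b2 := ENNReal.ofReal A * ENNReal.ofReal (Cμ * 2 ^ (d + 2))
  set b3 := ENNReal.ofReal A
  set b4 := ENNReal.ofReal (c ^ 2 * C)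
  calc _ = b1 * S + b2 * ν univ + b3 * R + b4 * (ν univ * ρ univ) := by ring
    _ ≤ B * S + B * ν univ + B * R + B * (ν univ * ρ univ) := by
        gcongr <;> rw [hB]
        · exact le_add_right (le_add_right le_self_add)
        · exact le_add_right (le_add_right le_add_self)
        · exact le_add_right le_add_self
        · exact le_add_self
    _ = _ := by ring

end Core

theorem exists_tendsto_of_eventually_abs_sub_le {l : Filter ℝ} [l.NeBot] {f : ℝ → ℝ}
    (h : ∀ δ > 0, ∃ c, ∀ᶠ ε in l, |f ε - c| ≤ δ) : ∃ a, Tendsto f l (𝓝 a) := by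
  refine cauchy_map_iff_exists_tendsto.1 (Metric.cauchy_iff.2 ⟨inferInstance, fun δ hδ => ?_⟩)
  obtain ⟨c, hc⟩ := h (δ / 3) (by positivity)
  refine ⟨closedBall c (δ / 3), mem_map.2 hc,
    fun x hx y hy => ?_⟩
  have := dist_triangle_right x y c
  rw [mem_closedBall] at hx hy
  linarith

/-- The truncated double integrals of `K` against `ν × ρ` converge. -/
def HasTruncLimit {F : Type*} [NormedAddCommGroup F] [MeasurableSpace F] (K : F → ℝ)
    (ν ρ : Measure F) : Prop :=
  ∃ l : ℝ, Tendsto (fun ε => ∫ q : F × F, truncKernel K ε (q.1 - q.2) ∂(ν.prod ρ))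
    (𝓝[>] 0) (𝓝 l)

theorem HasGrowth.lintegral_poisson_prod_ne_top {F : Type*} [PseudoMetricSpace F]
    [SecondCountableTopology F] [MeasurableSpace F] [OpensMeasurableSpace F] {ν ρ : Measure F}
    [SFinite ν] [IsFiniteMeasure ρ]
    {d : ℕ} {C : ℝ} (hν : HasGrowth ν d C) {s : F → ℝ} (hs : Measurable s) (hs0 : ∀ x, 0 ≤ s x) :
    ∫⁻ q : F × F, ENNReal.ofReal (s q.2 / (s q.2 + dist q.1 q.2) ^ (d + 1)) ∂(ν.prod ρ) ≠ ⊤ := by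
  rw [lintegral_prod_symm _ (Measurable.aemeasurable (by fun_prop))]
  refine ((lintegral_mono fun y => ?_).trans_lt (b := ∫⁻ _, ENNReal.ofReal (C * 2 ^ (d + 2)) ∂ρ)
    (by rw [lintegral_const]; finiteness)).ne
  rcases (hs0 y).eq_or_lt with h | h
  · simp [← h]
  · simp_rw [dist_comm _ y]
    exact hν.lintegral_poisson_le y h

section Integrable

variable {F : Type*} [NormedAddCommGroup F] [SecondCountableTopology F] [MeasurableSpace F]
  [BorelSpace F] {K : F → ℝ} {d : ℕ} {C : ℝ}

theorem integrable_truncKernel (hK : IsCZ K d C) (hcont : ContinuousOn K {0}ᶜ) {ε : ℝ}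
    (hε : 0 < ε) (m : Measure (F × F)) [IsFiniteMeasure m] :
    Integrable (fun q : F × F => truncKernel K ε (q.1 - q.2)) m :=
  Integrable.of_bound ((measurable_truncKernel hcont hε).comp measurable_sub).aestronglyMeasurable
    (C / ε ^ d) (Eventually.of_forall fun _ => abs_truncKernel_le hK hε _)

end Integrable

section Separated

variable {V F : Type*} [NormedAddCommGroup V] [InnerProductSpace ℝ V]
  [FiniteDimensional ℝ V] [MeasurableSpace V] [BorelSpace V]
  [NormedAddCommGroup F] [InnerProductSpace ℝ F] [SecondCountableTopology F]
  [MeasurableSpace F] [BorelSpace F]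
  {J : V →ₗᵢ[ℝ] F} {p : F →L[ℝ] V} {e : F}

/-- Measures separated by a hyperplane have convergent truncated integrals. -/
theorem IsSlicing.hasTruncLimit (h : IsSlicing J p e) {d : ℕ}
    (hd : Module.finrank ℝ V = d) {c : ℝ} (hV : HasGrowth (volume : Measure V) d c)
    {K : F → ℝ} {C : ℝ} (hK : IsCZ K d C) (hodd : ∀ x, K (-x) = -K x)
    (hcont : ContinuousOn K {0}ᶜ) {Cμ : ℝ} {ν ρ : Measure F} [IsFiniteMeasure ν]
    [IsFiniteMeasure ρ] (hν : HasGrowth ν d Cμ) (hρ : HasGrowth ρ d Cμ) {a : ℝ}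
    (hνa : ∀ᵐ x ∂ν, a < inner ℝ e x) (hρa : ∀ᵐ y ∂ρ, inner ℝ e y ≤ a) :
    HasTruncLimit K ν ρ := by
  obtain ⟨B, hBt, hB⟩ := h.exists_enorm_integral_truncKernel_le hd hV hK hodd hcont (Cμ := Cμ)
  set s : F → ℝ := fun x => |inner ℝ e x - a| with hs
  have hsm : Measurable s := by fun_prop
  have hs0 : ∀ x, 0 ≤ s x := fun x => abs_nonneg _
  have hsle : ∀ x y, |inner ℝ e (x - y)| ≤ s x + s y := fun x y => by
    rw [inner_sub_right]
    exact (abs_sub_le _ a _).trans_eq (by rw [hs, abs_sub_comm a])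
  have hae : ∀ᵐ q : F × F ∂(ν.prod ρ), a < inner ℝ e q.1 ∧ inner ℝ e q.2 ≤ a :=
    (Measure.quasiMeasurePreserving_fst.ae hνa).and (Measure.quasiMeasurePreserving_snd.ae hρa)
  set N : ℕ → Set F := fun j => {x | inner ℝ e x ≤ a + 1 / ((j : ℝ) + 1)} with hN
  have hNm : ∀ j, MeasurableSet (N j) := fun j => measurableSet_le (by fun_prop) (by fun_prop)
  have hres : ∀ s : Set F, (ν.restrict s).prod ρ = (ν.prod ρ).restrict (s ×ˢ univ) := fun s => by
    rw [← Measure.prod_restrict, Measure.restrict_univ]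
  have hν0 : Tendsto (fun j => ν (N j)) atTop (𝓝 0) := by
    have hanti : Antitone N := fun i j hij x hx => by
      have h1 : inner ℝ e x ≤ a + 1 / ((j : ℝ) + 1) := hx
      have h2 : 1 / ((j : ℝ) + 1) ≤ 1 / ((i : ℝ) + 1) := by gcongr
      exact h1.trans (by gcongr)
    have := tendsto_measure_iInter_atTop (μ := ν) (fun j => (hNm j).nullMeasurableSet) hanti
      ⟨0, measure_ne_top _ _⟩
    have h0 : ν (⋂ j, N j) = 0 := by
      refine measure_mono_null (fun x hx => ?_) (ae_iff.1 hνa)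
      rw [Set.mem_ofPred_eq, not_lt]
      have h1 : Tendsto (fun j : ℕ => a + 1 / ((j : ℝ) + 1)) atTop (𝓝 (a + 0)) :=
        tendsto_const_nhds.add tendsto_one_div_add_atTop_nhds_zero_nat
      rw [add_zero] at h1
      exact ge_of_tendsto h1 (Eventually.of_forall fun j => mem_iInter.1 hx j)
    rwa [h0] at this
  set Q : F × F → ℝ≥0∞ := fun q => ENNReal.ofReal (s q.2 / (s q.2 + dist q.1 q.2) ^ (d + 1))
    with hQ
  have hR0 : Tendsto (fun j => ∫⁻ q, Q q ∂((ν.restrict (N j)).prod ρ)) atTop (𝓝 0) := by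
    simp_rw [hres]
    refine tendsto_setLIntegral_zero (hν.lintegral_poisson_prod_ne_top hsm hs0) ?_
    have := ENNReal.Tendsto.mul_const (b := ρ univ) hν0 (Or.inr (measure_ne_top _ _))
    rw [zero_mul] at this
    exact this.congr fun j => (Measure.prod_prod _ _).symm
  set b : ℕ → ℝ≥0∞ := fun j => B * ((ν (N j) * ρ univ) ^ (1 / 2 : ℝ) + ν (N j)
    + ∫⁻ q, Q q ∂((ν.restrict (N j)).prod ρ) + ν (N j) * ρ univ) with hb
  have hb0 : Tendsto b atTop (𝓝 0) := by
    have h1 := ENNReal.Tendsto.mul_const (b := ρ univ) hν0 (Or.inr (measure_ne_top _ _))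
    rw [zero_mul] at h1
    have h2 := (ENNReal.continuous_rpow_const (y := 1 / 2)).tendsto 0 |>.comp h1
    rw [ENNReal.zero_rpow_of_pos (by norm_num)] at h2
    have h3 := ENNReal.Tendsto.const_mul (a := B) (((h2.add hν0).add hR0).add h1) (Or.inr hBt)
    simpa [hb] using h3
  refine exists_tendsto_of_eventually_abs_sub_le fun δ hδ => ?_
  obtain ⟨j, hj⟩ := (hb0.eventually_le_const (ENNReal.ofReal_pos.2 hδ)).exists
  have hj0 : (0 : ℝ) < 1 / ((j : ℝ) + 1) := by positivity
  refine ⟨∫ q : F × F in (N j)ᶜ ×ˢ univ, truncKernel K (1 / ((j : ℝ) + 1)) (q.1 - q.2) ∂(ν.prod ρ),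
    ?_⟩
  filter_upwards [Ioo_mem_nhdsGT hj0] with ε hε
  have hsplit := integral_add_compl ((hNm j).prod MeasurableSet.univ)
    (integrable_truncKernel hK hcont hε.1 (ν.prod ρ))
  have hcompl : (N j ×ˢ (univ : Set F))ᶜ = (N j)ᶜ ×ˢ univ := by
    ext q; simp
  have hfar : ∫ q : F × F in (N j)ᶜ ×ˢ univ, truncKernel K ε (q.1 - q.2) ∂(ν.prod ρ)
      = ∫ q : F × F in (N j)ᶜ ×ˢ univ, truncKernel K (1 / ((j : ℝ) + 1)) (q.1 - q.2)
        ∂(ν.prod ρ) := by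
    refine setIntegral_congr_ae ((hNm j).compl.prod MeasurableSet.univ)
      (hae.mono fun q hq hqN => ?_)
    have h1 : a + 1 / ((j : ℝ) + 1) < inner ℝ e q.1 := not_le.1 hqN.1
    have h2 : inner ℝ e (q.1 - q.2) ≤ ‖q.1 - q.2‖ := by
      simpa [h.norm_e] using real_inner_le_norm e (q.1 - q.2)
    rw [inner_sub_right] at h2
    have h3 : 1 / ((j : ℝ) + 1) < ‖q.1 - q.2‖ := by linarith [hq.2]
    rw [truncKernel, truncKernel, Set.indicator_of_mem (by exact hε.2.trans h3),
      Set.indicator_of_mem (by exact h3)]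
  rw [← hsplit, hcompl, hfar, add_sub_cancel_right, ← hres]
  have key := hB (ν.restrict (N j)) ρ (hν.restrict _) hρ s hsm hs0 hsle (by
    rw [hres]
    refine ae_restrict_of_ae (hae.mono fun q hq => ?_)
    have h1 : 0 ≤ inner ℝ e q.1 - a := by linarith [hq.1]
    have h2 : inner ℝ e q.2 - a ≤ 0 := by linarith [hq.2]
    rw [hs, inner_sub_right]
    simp only
    rw [abs_of_nonneg h1, abs_of_nonpos h2, abs_of_nonneg (by linarith)]
    ring) ε hε.1
  rw [Measure.restrict_apply_univ] at key
  have := key.trans hj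
  rw [Real.enorm_eq_ofReal_abs] at this
  exact (ENNReal.ofReal_le_ofReal_iff hδ.le).1 this

end Separated

section Algebra

variable {F : Type*} [NormedAddCommGroup F] [MeasurableSpace F] {K : F → ℝ}

theorem integral_truncKernel_swap (hodd : ∀ x, K (-x) = -K x) (ν ρ : Measure F) [SFinite ν]
    [SFinite ρ] (ε : ℝ) :
    ∫ q : F × F, truncKernel K ε (q.1 - q.2) ∂(ρ.prod ν)
      = -∫ q : F × F, truncKernel K ε (q.1 - q.2) ∂(ν.prod ρ) := by
  rw [← integral_prod_swap, ← integral_neg]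
  refine integral_congr_ae (Eventually.of_forall fun q => ?_)
  simp only [Prod.fst_swap, Prod.snd_swap]
  rw [← truncKernel_neg hodd, neg_sub]

theorem HasTruncLimit.swap (hodd : ∀ x, K (-x) = -K x) {ν ρ : Measure F} [SFinite ν]
    [SFinite ρ] (h : HasTruncLimit K ν ρ) : HasTruncLimit K ρ ν := by
  obtain ⟨l, hl⟩ := h
  refine ⟨-l, hl.neg.congr fun ε => ?_⟩
  rw [← integral_truncKernel_swap hodd]

theorem hasTruncLimit_self (hodd : ∀ x, K (-x) = -K x) (ν : Measure F) [SFinite ν] :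
    HasTruncLimit K ν ν := by
  refine ⟨0, tendsto_const_nhds.congr fun ε => ?_⟩
  linarith [integral_truncKernel_swap hodd ν ν ε]

theorem hasTruncLimit_zero (ρ : Measure F) : HasTruncLimit K 0 ρ :=
  ⟨0, tendsto_const_nhds.congr fun ε => by simp⟩

/-- A measurable set whose measurable subsets have convergent truncated integrals against the
measurable subsets of its complement. -/
structure IsTruncSeparating (K : F → ℝ) (μ : Measure F) (P : Set F) : Prop where
  measurableSet : MeasurableSet P
  hasTruncLimit : ∀ S A, MeasurableSet S → MeasurableSet A → Disjoint S P → A ⊆ P →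
    HasTruncLimit K (μ.restrict S) (μ.restrict A)

theorem isTruncSeparating_univ {μ : Measure F} : IsTruncSeparating K μ univ where
  measurableSet := MeasurableSet.univ
  hasTruncLimit S A _ _ hS _ := by
    rw [disjoint_univ.1 hS, Measure.restrict_empty]
    exact hasTruncLimit_zero _

variable [SecondCountableTopology F] [BorelSpace F] {d : ℕ} {C : ℝ}

theorem HasTruncLimit.add (hK : IsCZ K d C) (hcont : ContinuousOn K {0}ᶜ) {ν₁ ν₂ ρ : Measure F}
    [IsFiniteMeasure ν₁] [IsFiniteMeasure ν₂] [IsFiniteMeasure ρ] (h₁ : HasTruncLimit K ν₁ ρ)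
    (h₂ : HasTruncLimit K ν₂ ρ) : HasTruncLimit K (ν₁ + ν₂) ρ := by
  obtain ⟨l₁, hl₁⟩ := h₁
  obtain ⟨l₂, hl₂⟩ := h₂
  refine ⟨l₁ + l₂, (hl₁.add hl₂).congr' ?_⟩
  filter_upwards [self_mem_nhdsWithin] with ε hε
  rw [Measure.add_prod, integral_add_measure (integrable_truncKernel hK hcont hε _)
    (integrable_truncKernel hK hcont hε _)]

variable {μ : Measure F} [IsFiniteMeasure μ]

theorem HasTruncLimit.of_inter_of_diff (hK : IsCZ K d C) (hcont : ContinuousOn K {0}ᶜ)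
    {S N : Set F} (hN : MeasurableSet N) {ρ : Measure F} [IsFiniteMeasure ρ]
    (h₁ : HasTruncLimit K (μ.restrict (S ∩ N)) ρ) (h₂ : HasTruncLimit K (μ.restrict (S \ N)) ρ) :
    HasTruncLimit K (μ.restrict S) ρ := by
  rw [← Measure.restrict_inter_add_sdiff S hN]
  exact h₁.add hK hcont h₂

theorem IsTruncSeparating.inter (hK : IsCZ K d C) (hcont : ContinuousOn K {0}ᶜ) {P Q : Set F}
    (hP : IsTruncSeparating K μ P) (hQ : IsTruncSeparating K μ Q) :
    IsTruncSeparating K μ (P ∩ Q) where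
  measurableSet := hP.measurableSet.inter hQ.measurableSet
  hasTruncLimit S A hS hA hSP hAP := by
    refine HasTruncLimit.of_inter_of_diff hK hcont hP.measurableSet
      (hQ.hasTruncLimit _ _ (hS.inter hP.measurableSet) hA ?_ fun x hx => (hAP hx).2)
      (hP.hasTruncLimit _ _ (hS.diff hP.measurableSet) hA disjoint_sdiff_left
        fun x hx => (hAP hx).1)
    rw [Set.disjoint_left] at hSP ⊢
    exact fun x hx hxQ => hSP hx.1 ⟨hx.2, hxQ⟩

theorem IsTruncSeparating.iInter (hK : IsCZ K d C) (hcont : ContinuousOn K {0}ᶜ) {ι : Type*}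
    [Finite ι] {P : ι → Set F} (hP : ∀ i, IsTruncSeparating K μ (P i)) :
    IsTruncSeparating K μ (⋂ i, P i) := by
  have : Fintype ι := Fintype.ofFinite ι
  suffices h : ∀ t : Finset ι, IsTruncSeparating K μ (⋂ i ∈ t, P i) by
    simpa using h Finset.univ
  intro t
  induction t using Finset.cons_induction with
  | empty => simpa using isTruncSeparating_univ
  | cons i t hi ih => simpa using (hP i).inter hK hcont ih

theorem IsTruncSeparating.hasTruncLimit_pair (hK : IsCZ K d C) (hcont : ContinuousOn K {0}ᶜ)
    (hodd : ∀ x, K (-x) = -K x) {P Q : Set F} (hP : IsTruncSeparating K μ P)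
    (hQ : IsTruncSeparating K μ Q) : HasTruncLimit K (μ.restrict Q) (μ.restrict P) := by
  have hPm := hP.measurableSet
  have hQm := hQ.measurableSet
  refine HasTruncLimit.of_inter_of_diff hK hcont hPm (HasTruncLimit.swap hodd ?_)
    (hP.hasTruncLimit _ _ (hQm.diff hPm) hPm disjoint_sdiff_left subset_rfl)
  refine HasTruncLimit.of_inter_of_diff hK hcont hQm ?_
    (hQ.hasTruncLimit _ _ (hPm.diff hQm) (hQm.inter hPm) disjoint_sdiff_left inter_subset_left)
  rw [inter_comm]
  exact hasTruncLimit_self hodd _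

end Algebra

section HalfSpace

theorem exists_hasGrowth_volume (V : Type*) [NormedAddCommGroup V] [InnerProductSpace ℝ V]
    [FiniteDimensional ℝ V] [MeasurableSpace V] [BorelSpace V] :
    ∃ c, HasGrowth (volume : Measure V) (Module.finrank ℝ V) c := by
  refine ⟨(volume (ball (0 : V) 1)).toReal, ENNReal.toReal_nonneg, fun x r hr => ?_⟩
  rw [Measure.addHaar_closedBall _ _ hr.le, mul_comm, ENNReal.ofReal_mul ENNReal.toReal_nonneg,
    ENNReal.ofReal_toReal measure_ball_lt_top.ne]

variable {F : Type*} [NormedAddCommGroup F] [InnerProductSpace ℝ F]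

theorem isSlicing_orthogonal {e : F} (he : ‖e‖ = 1) :
    IsSlicing (ℝ ∙ e)ᗮ.subtypeₗᵢ (ℝ ∙ e)ᗮ.orthogonalProjectionOnto e where
  norm_e := he
  inner_e v := Submodule.mem_orthogonal_singleton_iff_inner_right.1 v.2
  decomp x := by
    rw [← Submodule.starProjection_unit_singleton ℝ he x, add_comm]
    exact Submodule.starProjection_add_starProjection_orthogonal (K := ℝ ∙ e) x

variable [FiniteDimensional ℝ F] [MeasurableSpace F] [BorelSpace F]

theorem isTruncSeparating_halfSpace {d : ℕ} (hd : Module.finrank ℝ F = d + 1) {e : F}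
    (he : ‖e‖ = 1) {K : F → ℝ} {C : ℝ} (hK : IsCZ K d C) (hodd : ∀ x, K (-x) = -K x)
    (hcont : ContinuousOn K {0}ᶜ) {Cμ : ℝ} {μ : Measure F} [IsFiniteMeasure μ]
    (hμ : HasGrowth μ d Cμ) (a : ℝ) : IsTruncSeparating K μ {x | inner ℝ e x ≤ a} where
  measurableSet := measurableSet_le (by fun_prop) (by fun_prop)
  hasTruncLimit S A hS hA hSP hAP := by
    have : Fact (Module.finrank ℝ F = d + 1) := ⟨hd⟩
    have hd' : Module.finrank ℝ (ℝ ∙ e)ᗮ = d :=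
      Submodule.finrank_orthogonal_span_singleton (by rintro rfl; simp at he)
    obtain ⟨c, hc⟩ := exists_hasGrowth_volume (ℝ ∙ e)ᗮ
    rw [hd'] at hc
    refine (isSlicing_orthogonal he).hasTruncLimit hd' hc hK hodd hcont (hμ.restrict S)
      (hμ.restrict A) (a := a) ((ae_restrict_iff' hS).2 (Eventually.of_forall fun x hx => ?_))
      ((ae_restrict_iff' hA).2 (Eventually.of_forall fun x hx => hAP hx))
    exact not_le.1 fun hxa => Set.disjoint_left.1 hSP hx hxa

end HalfSpace

theorem IsCZ.indicator_compl_zero {V : Type*} [NormedAddCommGroup V] {K : V → ℝ} {d : ℕ} {C : ℝ}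
    (hK : IsCZ K d C) : IsCZ (Set.indicator {0}ᶜ K) d C where
  size u := by
    by_cases hu : u = 0
    · simpa [hu] using hK.nonneg
    · rw [Set.indicator_of_mem (by simpa using hu)]
      exact hK.size u
  smooth u w huw := by
    have hC := hK.nonneg
    by_cases hu : u = 0
    · have : w = 0 := by simpa [hu] using huw
      simp [hu, this]
    have hw : w ≠ 0 := fun hw => by
      have := norm_pos_iff.2 hu
      rw [hw, sub_zero] at huw
      linarith
    rw [Set.indicator_of_mem (by simpa using hu), Set.indicator_of_mem (by simpa using hw)]
    exact hK.smooth u w huw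

section Rectangle

variable {n : ℕ}

theorem closedRectangle_eq_iInter
    (R : EuclideanSpace ℝ (Fin n) ≃ₗᵢ[ℝ] EuclideanSpace ℝ (Fin n))
    (v : EuclideanSpace ℝ (Fin n)) (lo hi : Fin n → ℝ) :
    closedRectangle R v lo hi = ⋂ i,
      ({x | inner ℝ (R (EuclideanSpace.single i 1)) x
          ≤ hi i + inner ℝ (R (EuclideanSpace.single i 1)) v} ∩
        {x | inner ℝ (-R (EuclideanSpace.single i 1)) x
          ≤ -(lo i + inner ℝ (R (EuclideanSpace.single i 1)) v)}) := by
  have hcoord : ∀ (x : EuclideanSpace ℝ (Fin n)) i,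
      inner ℝ (R (EuclideanSpace.single i 1)) x
        = R.symm (x - v) i + inner ℝ (R (EuclideanSpace.single i 1)) v := fun x i => by
    have h1 : R (R.symm (x - v)) = x - v := R.apply_symm_apply _
    have h2 : inner ℝ (EuclideanSpace.single i (1 : ℝ)) (R.symm (x - v)) = R.symm (x - v) i := by
      simp [EuclideanSpace.inner_single_left]
    rw [← h2, ← R.inner_map_map (EuclideanSpace.single i 1) (R.symm _), h1, inner_sub_right,
      sub_add_cancel]
  ext x
  simp only [mem_iInter, mem_inter_iff, Set.mem_ofPred_eq, inner_neg_left, neg_le_neg_iff,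
    closedRectangle, mem_image]
  constructor
  · rintro ⟨y, hy, rfl⟩ i
    rw [hcoord (R y + v)]
    simpa using (hy i).symm
  · refine fun h => ⟨R.symm (x - v), fun i => ?_, by simp⟩
    have := h i
    rw [hcoord x] at this
    constructor <;> linarith

theorem isTruncSeparating_closedRectangle {d : ℕ}
    {K : EuclideanSpace ℝ (Fin (d + 1)) → ℝ} {C : ℝ} (hK : IsCZ K d C)
    (hodd : ∀ x, K (-x) = -K x) (hcont : ContinuousOn K {0}ᶜ) {Cμ : ℝ}
    {μ : Measure (EuclideanSpace ℝ (Fin (d + 1)))} [IsFiniteMeasure μ] (hμ : HasGrowth μ d Cμ)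
    (R : EuclideanSpace ℝ (Fin (d + 1)) ≃ₗᵢ[ℝ] EuclideanSpace ℝ (Fin (d + 1)))
    (v : EuclideanSpace ℝ (Fin (d + 1))) (lo hi : Fin (d + 1) → ℝ) :
    IsTruncSeparating K μ (closedRectangle R v lo hi) := by
  rw [closedRectangle_eq_iInter]
  refine IsTruncSeparating.iInter hK hcont fun i => IsTruncSeparating.inter hK hcont ?_ ?_
  · exact isTruncSeparating_halfSpace finrank_euclideanSpace_fin (by simp) hK hodd hcont hμ _
  · exact isTruncSeparating_halfSpace finrank_euclideanSpace_fin (by simp) hK hodd hcont hμ _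

theorem trunc_eq_integral_truncKernel (μ : Measure (EuclideanSpace ℝ (Fin n)))
    (K : EuclideanSpace ℝ (Fin n) → ℝ) {ε : ℝ} (hε : 0 < ε) (g : EuclideanSpace ℝ (Fin n) → ℝ)
    (x : EuclideanSpace ℝ (Fin n)) :
    trunc μ K ε g x = ∫ y, truncKernel (Set.indicator {0}ᶜ K) ε (x - y) * g y ∂μ := by
  rw [trunc, ← integral_indicator isClosed_closedBall.measurableSet.compl]
  refine integral_congr_ae (Eventually.of_forall fun y => ?_)
  by_cases hy : ε < ‖x - y‖
  · have h0 : x - y ≠ 0 := norm_pos_iff.1 (hε.trans hy)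
    simp only [truncKernel]
    rw [Set.indicator_of_mem (by simpa [dist_comm y, dist_eq_norm] using hy),
      Set.indicator_of_mem (by exact hy), Set.indicator_of_mem (by exact h0)]
  · simp only [truncKernel]
    rw [Set.indicator_of_notMem (by simpa [dist_comm y, dist_eq_norm] using hy),
      Set.indicator_of_notMem (by exact hy), zero_mul]

theorem integral_trunc_mul_eq_sum {K : EuclideanSpace ℝ (Fin n) → ℝ} {d : ℕ} {C : ℝ}
    (hK : IsCZ (Set.indicator {0}ᶜ K) d C)
    (hcont : ContinuousOn (Set.indicator {0}ᶜ K) {0}ᶜ) (μ : Measure (EuclideanSpace ℝ (Fin n)))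
    [IsFiniteMeasure μ] {ι κ : Type*} [Fintype ι] [Fintype κ] (a : ι → ℝ) (b : κ → ℝ)
    {A : ι → Set (EuclideanSpace ℝ (Fin n))} {B : κ → Set (EuclideanSpace ℝ (Fin n))}
    (hA : ∀ i, MeasurableSet (A i)) (hB : ∀ j, MeasurableSet (B j)) {ε : ℝ} (hε : 0 < ε) :
    ∫ x, trunc μ K ε (fun y => ∑ i, a i * (A i).indicator (fun _ => (1 : ℝ)) y) x *
        (∑ j, b j * (B j).indicator (fun _ => (1 : ℝ)) x) ∂μ
      = ∑ j, ∑ i, b j * (a i * ∫ q, truncKernel (Set.indicator {0}ᶜ K) ε (q.1 - q.2)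
        ∂((μ.restrict (B j)).prod (μ.restrict (A i)))) := by
  set k := truncKernel (Set.indicator {0}ᶜ K) ε
  have hki := integrable_truncKernel hK hcont hε (μ.prod μ)
  have hint : ∀ j i, Integrable (fun q : EuclideanSpace ℝ (Fin n) × EuclideanSpace ℝ (Fin n) =>
      b j * (a i * (B j ×ˢ A i).indicator (fun q => k (q.1 - q.2)) q)) (μ.prod μ) := fun j i =>
    ((hki.indicator ((hB j).prod (hA i))).const_mul _).const_mul _
  have e1 : ∀ x y, k (x - y) * (∑ i, a i * (A i).indicator (fun _ => (1 : ℝ)) y)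
      * (∑ j, b j * (B j).indicator (fun _ => (1 : ℝ)) x)
      = ∑ j, ∑ i, b j * (a i * (B j ×ˢ A i).indicator (fun q => k (q.1 - q.2)) (x, y)) := by
    intro x y
    rw [mul_comm, Finset.sum_mul]
    refine Finset.sum_congr rfl fun j _ => ?_
    rw [Finset.mul_sum, Finset.mul_sum]
    refine Finset.sum_congr rfl fun i _ => ?_
    by_cases hx : x ∈ B j <;> by_cases hy : y ∈ A i <;> simp [hx, hy]
    exact Or.inl (mul_comm _ _)
  have e2 : ∀ x, trunc μ K ε (fun y => ∑ i, a i * (A i).indicator (fun _ => (1 : ℝ)) y) x *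
        (∑ j, b j * (B j).indicator (fun _ => (1 : ℝ)) x)
      = ∫ y, ∑ j, ∑ i, b j * (a i * (B j ×ˢ A i).indicator (fun q => k (q.1 - q.2)) (x, y)) ∂μ := by
    intro x
    rw [trunc_eq_integral_truncKernel μ K hε, ← integral_mul_const]
    simp_rw [← e1]
    rfl
  simp_rw [e2]
  rw [integral_integral (f := fun x y => ∑ j, ∑ i, b j * (a i *
    (B j ×ˢ A i).indicator (fun q => k (q.1 - q.2)) (x, y)))
    (integrable_finsetSum _ fun j _ => integrable_finsetSum _ fun i _ => hint j i),
    integral_finsetSum _ fun j _ => integrable_finsetSum _ fun i _ => hint j i]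
  refine Finset.sum_congr rfl fun j _ => ?_
  rw [integral_finsetSum _ fun i _ => hint j i]
  refine Finset.sum_congr rfl fun i _ => ?_
  rw [integral_const_mul, integral_const_mul, integral_indicator ((hB j).prod (hA i)),
    Measure.prod_restrict]

end Rectangle

/-- If `μ ∈ Δ` is a finite measure on `ℝⁿ` (`n ≥ 2`) and `K ∈ 𝒦`, then for `f`
and `g` finite linear combinations of characteristic functions of closed rectangles (not
necessarily with sides parallel to the axes), the limit
`lim_{ε→0} ∫ T^ε_{μ,K} f · g dμ` exists and is finite. -/
theorem statement7 (n : ℕ) (hn : 2 ≤ n)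
    (μ : Measure (EuclideanSpace ℝ (Fin n))) [IsFiniteMeasure μ]
    (Cμ : ℝ)
    (hμΔ : ∀ (x : EuclideanSpace ℝ (Fin n)) (r : ℝ), 0 < r →
      μ (closedBall x r) ≤ ENNReal.ofReal (Cμ * r ^ (n - 1)))
    (K : EuclideanSpace ℝ (Fin n) → ℝ) (C₀ C₁ : ℝ)
    (hK_diff : ContDiffOn ℝ 1 K {0}ᶜ)
    (hK_anti : ∀ x : EuclideanSpace ℝ (Fin n), x ≠ 0 → K (-x) = -K x)
    (hK_size : ∀ x : EuclideanSpace ℝ (Fin n), x ≠ 0 →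
      |K x| ≤ C₀ * ‖x‖ ^ (-((n : ℝ) - 1)))
    (hK_grad : ∀ x : EuclideanSpace ℝ (Fin n), x ≠ 0 →
      ‖fderiv ℝ K x‖ ≤ C₁ * ‖x‖ ^ (-(n : ℝ)))
    (l k : ℕ) (a : Fin l → ℝ) (b : Fin k → ℝ)
    (R : Fin l → (EuclideanSpace ℝ (Fin n) ≃ₗᵢ[ℝ] EuclideanSpace ℝ (Fin n)))
    (v : Fin l → EuclideanSpace ℝ (Fin n)) (lo hi : Fin l → Fin n → ℝ)
    (R' : Fin k → (EuclideanSpace ℝ (Fin n) ≃ₗᵢ[ℝ] EuclideanSpace ℝ (Fin n)))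
    (v' : Fin k → EuclideanSpace ℝ (Fin n)) (lo' hi' : Fin k → Fin n → ℝ) :
    ∃ lim : ℝ, Tendsto (fun ε : ℝ =>
        ∫ x, trunc μ K ε
            (fun y => ∑ i, a i *
              (closedRectangle (R i) (v i) (lo i) (hi i)).indicator (fun _ => (1 : ℝ)) y) x *
          (∑ j, b j *
            (closedRectangle (R' j) (v' j) (lo' j) (hi' j)).indicator (fun _ => (1 : ℝ)) x) ∂μ)
      (𝓝[>] 0) (𝓝 lim) := by
  obtain ⟨d, rfl⟩ : ∃ d, n = d + 1 := ⟨n - 1, by omega⟩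
  have hμ : HasGrowth μ d |Cμ| := ⟨abs_nonneg _, fun x r hr => (hμΔ x r hr).trans <|
    ENNReal.ofReal_le_ofReal (by rw [Nat.add_sub_cancel]; gcongr; exact le_abs_self _)⟩
  have hcz : IsCZ K d (|C₀| + |C₁| * 2 ^ (d + 1)) := by
    refine isCZ_of_norm_fderiv_le (by omega) (abs_nonneg _) (abs_nonneg _) (fun x hx => ?_)
      (fun x hx => ?_) fun x hx => ?_
    · exact (hK_diff.differentiableOn one_ne_zero).differentiableAt
        (isOpen_compl_singleton.mem_nhds hx)
    · have h := hK_size x hx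
      have hx0 := norm_pos_iff.2 hx
      rw [Nat.cast_add_one, add_sub_cancel_right, Real.rpow_neg hx0.le, Real.rpow_natCast,
        ← div_eq_mul_inv, le_div_iff₀ (by positivity)] at h
      exact h.trans (le_abs_self _)
    · have h := hK_grad x hx
      have hx0 := norm_pos_iff.2 hx
      rw [Real.rpow_neg hx0.le, Real.rpow_natCast, ← div_eq_mul_inv,
        le_div_iff₀ (by positivity)] at h
      exact h.trans (le_abs_self _)
  have hcont : ContinuousOn (Set.indicator {0}ᶜ K) {0}ᶜ :=
    hK_diff.continuousOn.congr fun x hx => Set.indicator_of_mem hx _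
  have hodd : ∀ x, Set.indicator {0}ᶜ K (-x)
      = -Set.indicator {0}ᶜ K x := fun x => by
    by_cases hx : x = 0
    · simp [hx]
    · rw [Set.indicator_of_mem (by simpa using hx), Set.indicator_of_mem (by simpa using hx),
        hK_anti x hx]
  have hA := fun i => isTruncSeparating_closedRectangle hcz.indicator_compl_zero hodd hcont hμ
    (R i) (v i) (lo i) (hi i)
  have hB := fun j => isTruncSeparating_closedRectangle hcz.indicator_compl_zero hodd hcont hμ
    (R' j) (v' j) (lo' j) (hi' j)
  choose L hL using fun j i =>
    (hA i).hasTruncLimit_pair hcz.indicator_compl_zero hcont hodd (hB j)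
  refine ⟨∑ j, ∑ i, b j * (a i * L j i), Tendsto.congr' ?_ (tendsto_finsetSum _ fun j _ =>
    tendsto_finsetSum _ fun i _ => ((hL j i).const_mul (a i)).const_mul (b j))⟩
  filter_upwards [self_mem_nhdsWithin] with ε hε
  exact (integral_trunc_mul_eq_sum hcz.indicator_compl_zero hcont μ a b
    (fun i => (hA i).measurableSet) (fun j => (hB j).measurableSet) hε).symm
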